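/- arXiv:2310.10401 — 9 statements merged into one kernel-verified Lean document; each statement's English description precedes it below -/
import Mathlib

section
/- Let n ≥ 3 be an integer and let x_1, …, x_n be real numbers with 0 < x_i < 1 for all i and 1 < x_1 + … + x_n < n − 1. For j ∈ {1,…,n} set s_j := x_1 + … + x_j. Then there exists an integer r with 3 ≤ r ≤ n such that s_{r−2} is not an integer, s_r is not an integer, and 1 < s_r − ⌊s_{r−2}⌋ < 2. -/
/-- No integer lies strictly between two consecutive integers. -/
theorem not_exists_eq_intCast_of_lt_of_lt {a : ℝ} {m : ℤ} (h₁ : (m : ℝ) < a)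
    (h₂ : a < m + 1) : ¬ ∃ z : ℤ, a = (z : ℝ) := by
  rintro ⟨z, rfl⟩
  have h₃ : m < z := by exact_mod_cast h₁
  have h₄ : z < m + 1 := by exact_mod_cast h₂
  omega

/-- If `a` and `b` lie strictly inside consecutive unit intervals with integer endpoints, then
neither is an integer and `b - ⌊a⌋` lies strictly between `1` and `2`. -/
theorem not_int_and_sub_floor_mem {a b : ℝ} (m : ℤ) (ha₁ : (m : ℝ) < a) (ha₂ : a < m + 1)
    (hb₁ : (m : ℝ) + 1 < b) (hb₂ : b < m + 2) :
    (¬ ∃ z : ℤ, a = (z : ℝ)) ∧ (¬ ∃ z : ℤ, b = (z : ℝ)) ∧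
      1 < b - (⌊a⌋ : ℝ) ∧ b - (⌊a⌋ : ℝ) < 2 := by
  have hf : ⌊a⌋ = m := Int.floor_eq_iff.2 ⟨ha₁.le, ha₂⟩
  refine ⟨not_exists_eq_intCast_of_lt_of_lt ha₁ ha₂,
    not_exists_eq_intCast_of_lt_of_lt (m := m + 1) ?_ ?_, ?_, ?_⟩
  · push_cast; linarith
  · push_cast; linarith
  · rw [hf]; linarith
  · rw [hf]; linarith

/-- A sequence starting at `0` with increments in `(0,1)` up to time `n` and with
`1 < S n < n - 1` has two terms `S k`, `S (k + 2)` strictly inside consecutive unit intervals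
with integer endpoints. -/
theorem exists_consecutive_unit_intervals (n : ℕ) (S : ℕ → ℝ) (h0 : S 0 = 0)
    (hS : ∀ i < n, S i < S (i + 1) ∧ S (i + 1) < S i + 1)
    (h₁ : 1 < S n) (h₂ : S n < (n : ℝ) - 1) :
    ∃ k : ℕ, 1 ≤ k ∧ k + 2 ≤ n ∧ ∃ m : ℤ,
      (m : ℝ) < S k ∧ S k < m + 1 ∧ (m : ℝ) + 1 < S (k + 2) ∧ S (k + 2) < m + 2 := by
  classical
  have hn : 3 ≤ n := by
    have h : (2 : ℝ) < n := by linarith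
    exact_mod_cast h
  have hpos : ∀ i < n, 0 < S (i + 1) := by
    intro i
    induction i with
    | zero => intro hi; linarith [(hS 0 hi).1]
    | succ i ih => intro hi; linarith [(hS (i + 1) hi).1, ih (by omega)]
  have hlt : ∀ i < n, S (i + 1) < i + 1 := by
    intro i
    induction i with
    | zero => intro hi; have := (hS 0 hi).2; push_cast; linarith
    | succ i ih =>
      intro hi
      have := (hS (i + 1) hi).2
      have := ih (by omega)
      push_cast
      linarith
  have hS1 : S 1 < 1 := by simpa using hlt 0 (by omega)
  have hS1' : 0 < S 1 := hpos 0 (by omega)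
  by_cases hS2 : S 2 ≤ 1
  · -- the first time the sequence exceeds `1`
    have hex : ∃ k, 1 < S k := ⟨n, h₁⟩
    obtain ⟨k, hk, hkn, hmin⟩ : ∃ k, 1 < S k ∧ k ≤ n ∧ ∀ j < k, S j ≤ 1 :=
      ⟨Nat.find hex, Nat.find_spec hex, Nat.find_min' hex h₁,
        fun j hj => not_lt.1 (Nat.find_min hex hj)⟩
    match k, hk, hkn, hmin with
    | 0, hk, _, _ => linarith
    | 1, hk, _, _ => linarith
    | 2, hk, _, _ => linarith
    | k + 3, hk, hkn, hmin =>
      have a := hmin (k + 2) (by omega)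
      have b := (hS (k + 1) (by omega)).1
      have c := (hS (k + 2) (by omega)).2
      refine ⟨k + 1, by omega, by omega, 0, ?_, ?_, ?_, ?_⟩ <;> push_cast
      · exact hpos k (by omega)
      · linarith
      · linarith
      · linarith
  · -- the first time the sequence drops out of the intervals `(k - 1, k)`
    have hex : ∃ k : ℕ, 1 ≤ k ∧ S k ≤ (k : ℝ) - 1 := ⟨n, by omega, h₂.le⟩
    obtain ⟨k, ⟨hk1, hk⟩, hkn, hmin⟩ : ∃ k : ℕ, (1 ≤ k ∧ S k ≤ (k : ℝ) - 1) ∧ k ≤ n ∧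
        ∀ j < k, 1 ≤ j → (j : ℝ) - 1 < S j :=
      ⟨Nat.find hex, Nat.find_spec hex, Nat.find_min' hex ⟨by omega, h₂.le⟩,
        fun j hj h1 => not_le.1 fun h => Nat.find_min hex hj ⟨h1, h⟩⟩
    match k, hk1, hk, hkn, hmin with
    | 1, _, hk, _, _ => norm_num at hk; linarith
    | 2, _, hk, _, _ => norm_num at hk; linarith
    | k + 3, _, hk, hkn, hmin =>
      have a := hmin (k + 1) (by omega) (by omega)
      have b := hmin (k + 2) (by omega) (by omega)
      have c := hlt k (by omega)
      have d := (hS (k + 2) (by omega)).1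
      push_cast at a b hk
      rcases hk.lt_or_eq with hk | hk
      · refine ⟨k + 1, by omega, by omega, k, ?_, ?_, ?_, ?_⟩ <;> push_cast <;> linarith
      · have hne : k + 3 ≠ n := by
          rintro rfl
          push_cast at h₂
          linarith
        have e := hS (k + 3) (by omega)
        refine ⟨k + 2, by omega, by omega, k + 1, ?_, ?_, ?_, ?_⟩ <;> push_cast <;> linarith


/-- Lemma 5.1: among the partial sums `s_j = x_1 + … + x_j` of a sequence of reals in `(0,1)`
whose total sum lies strictly between `1` and `n-1`, there is an index `3 ≤ r ≤ n` with
`s_{r-2}, s_r ∉ ℤ` and `1 < s_r − ⌊s_{r-2}⌋ < 2`. -/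
theorem stmt_0 (n : ℕ) (hn : 3 ≤ n) (x : ℕ → ℝ)
    (hx : ∀ i ∈ Finset.Icc 1 n, 0 < x i ∧ x i < 1)
    (hsum₁ : 1 < ∑ i ∈ Finset.Icc 1 n, x i)
    (hsum₂ : ∑ i ∈ Finset.Icc 1 n, x i < (n : ℝ) - 1) :
    ∃ r : ℕ, 3 ≤ r ∧ r ≤ n ∧
      (¬ ∃ z : ℤ, (∑ i ∈ Finset.Icc 1 (r - 2), x i) = (z : ℝ)) ∧
      (¬ ∃ z : ℤ, (∑ i ∈ Finset.Icc 1 r, x i) = (z : ℝ)) ∧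
      1 < (∑ i ∈ Finset.Icc 1 r, x i) - (⌊∑ i ∈ Finset.Icc 1 (r - 2), x i⌋ : ℝ) ∧
      (∑ i ∈ Finset.Icc 1 r, x i) - (⌊∑ i ∈ Finset.Icc 1 (r - 2), x i⌋ : ℝ) < 2 := by
  obtain ⟨k, hk1, hkn, m, h⟩ := exists_consecutive_unit_intervals n
    (fun j => ∑ i ∈ Finset.Icc 1 j, x i) (by simp) (fun i hi => by
      have := hx (i + 1) (Finset.mem_Icc.2 ⟨by omega, by omega⟩)
      simp only [Finset.sum_Icc_succ_top (Nat.le_add_left 1 i)]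
      constructor <;> linarith) hsum₁ hsum₂
  exact ⟨k + 2, by omega, hkn, not_int_and_sub_floor_mem m h.1 h.2.1 h.2.2.1 h.2.2.2⟩
end

section
/- Let d ≥ 2 and n ≥ 3 be integers, and let k_1, …, k_n be integers with 0 < k_i < d for all i. Suppose there is an integer m with 2 ≤ m ≤ n − 1 such that d divides k_1 + … + k_m. Then for every integer k coprime to d one has: 0 < {k·k_i/d} < 1 for every i; 1 ≤ {k·k_1/d} + … + {k·k_m/d} ≤ m − 1; and 1 < {k·k_1/d} + … + {k·k_n/d} < n − 1. -/
theorem fract_intCast_div_pos_of_not_dvd {d : ℕ} (hd : 0 < d) {a : ℤ} (h : ¬ (d : ℤ) ∣ a) :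
    0 < Int.fract ((a : ℝ) / (d : ℝ)) := by
  refine Int.fract_pos.2 fun he => h ⟨⌊(a : ℝ) / (d : ℝ)⌋, ?_⟩
  have hd' : (d : ℝ) ≠ 0 := by positivity
  rw [div_eq_iff hd', mul_comm] at he
  exact_mod_cast he

theorem exists_intCast_eq_sum_fract {ι : Type*} (s : Finset ι) (f : ι → ℝ)
    (h : ∃ z : ℤ, ∑ i ∈ s, f i = z) : ∃ z : ℤ, ∑ i ∈ s, Int.fract (f i) = z := by
  obtain ⟨z, hz⟩ := h
  refine ⟨z - ∑ i ∈ s, ⌊f i⌋, ?_⟩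
  simp only [Int.fract, Finset.sum_sub_distrib, hz]
  push_cast
  rfl

theorem one_le_sum_fract_and_le_card_sub_one {ι : Type*} {s : Finset ι} (hs : s.Nonempty)
    {f : ι → ℝ} (hpos : ∀ i ∈ s, 0 < Int.fract (f i)) (h : ∃ z : ℤ, ∑ i ∈ s, f i = z) :
    1 ≤ ∑ i ∈ s, Int.fract (f i) ∧ ∑ i ∈ s, Int.fract (f i) ≤ (s.card : ℝ) - 1 := by
  obtain ⟨z, hz⟩ := exists_intCast_eq_sum_fract s f h
  have h₀ : 0 < ∑ i ∈ s, Int.fract (f i) := Finset.sum_pos hpos hs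
  have h₁ : ∑ i ∈ s, Int.fract (f i) < ∑ _i ∈ s, (1 : ℝ) :=
    Finset.sum_lt_sum_of_nonempty hs fun i _ => Int.fract_lt_one _
  rw [Finset.sum_const, nsmul_one] at h₁
  rw [hz] at h₀ h₁ ⊢
  have hz₀ : 0 < z := by exact_mod_cast h₀
  have hz₁ : z < (s.card : ℤ) := by exact_mod_cast h₁
  have hz₂ : z ≤ (s.card : ℤ) - 1 := by lia
  exact ⟨by exact_mod_cast hz₀, by exact_mod_cast hz₂⟩


/-- Lemma 7.4: if `d` divides an initial partial sum `k_1 + … + k_m` (with `2 ≤ m ≤ n − 1`),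
then for every `k` coprime to `d` the fractional parts `{k·k_i/d}` lie in `(0,1)`, their sum over
`i ≤ m` lies in `[1, m−1]`, and their total sum lies strictly between `1` and `n − 1`. -/
theorem stmt_1 (d n : ℕ) (hd : 2 ≤ d) (hn : 3 ≤ n) (k : ℕ → ℤ)
    (hk : ∀ i ∈ Finset.Icc 1 n, 0 < k i ∧ k i < (d : ℤ))
    (m : ℕ) (hm₁ : 2 ≤ m) (hm₂ : m ≤ n - 1)
    (hdiv : (d : ℤ) ∣ ∑ i ∈ Finset.Icc 1 m, k i) :
    ∀ k' : ℤ, IsCoprime k' (d : ℤ) →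
      (∀ i ∈ Finset.Icc 1 n,
          0 < Int.fract (((k' * k i : ℤ) : ℝ) / (d : ℝ)) ∧
          Int.fract (((k' * k i : ℤ) : ℝ) / (d : ℝ)) < 1) ∧
      (1 ≤ ∑ i ∈ Finset.Icc 1 m, Int.fract (((k' * k i : ℤ) : ℝ) / (d : ℝ)) ∧
        ∑ i ∈ Finset.Icc 1 m, Int.fract (((k' * k i : ℤ) : ℝ) / (d : ℝ)) ≤ (m : ℝ) - 1) ∧
      (1 < ∑ i ∈ Finset.Icc 1 n, Int.fract (((k' * k i : ℤ) : ℝ) / (d : ℝ)) ∧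
        ∑ i ∈ Finset.Icc 1 n, Int.fract (((k' * k i : ℤ) : ℝ) / (d : ℝ)) < (n : ℝ) - 1) := by
  intro k' hk'
  have hd₀ : 0 < d := by lia
  have hpos : ∀ i ∈ Finset.Icc 1 n, 0 < Int.fract (((k' * k i : ℤ) : ℝ) / (d : ℝ)) := by
    intro i hi
    refine fract_intCast_div_pos_of_not_dvd hd₀ fun hdvd => ?_
    obtain ⟨h₀, h₁⟩ := hk i hi
    exact absurd (Int.le_of_dvd h₀ (hk'.symm.dvd_of_dvd_mul_left hdvd)) (by lia)
  have hsub : Finset.Icc 1 m ⊆ Finset.Icc 1 n := Finset.Icc_subset_Icc le_rfl (by lia)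
  have hint : ∃ z : ℤ, ∑ i ∈ Finset.Icc 1 m, ((k' * k i : ℤ) : ℝ) / (d : ℝ) = z := by
    obtain ⟨c, hc⟩ := hdiv
    refine ⟨k' * c, ?_⟩
    have hd' : (d : ℝ) ≠ 0 := by positivity
    rw [← Finset.sum_div, ← Int.cast_sum, ← Finset.mul_sum, hc, div_eq_iff hd']
    push_cast
    ring
  have hm := one_le_sum_fract_and_le_card_sub_one (Finset.nonempty_Icc.2 (by lia : 1 ≤ m))
    (fun i hi => hpos i (hsub hi)) hint
  rw [Nat.card_Icc, Nat.add_sub_cancel] at hm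
  refine ⟨fun i hi => ⟨hpos i hi, Int.fract_lt_one _⟩, hm, ?_⟩
  have hne : (Finset.Icc 1 n \ Finset.Icc 1 m).Nonempty :=
    ⟨n, by simp only [Finset.mem_sdiff, Finset.mem_Icc]; lia⟩
  have hlow := Finset.sum_pos (fun i hi => hpos i (Finset.sdiff_subset hi)) hne
  have hupp : ∑ i ∈ Finset.Icc 1 n \ Finset.Icc 1 m, Int.fract (((k' * k i : ℤ) : ℝ) / (d : ℝ)) <
      ∑ _i ∈ Finset.Icc 1 n \ Finset.Icc 1 m, (1 : ℝ) :=
    Finset.sum_lt_sum_of_nonempty hne fun i _ => Int.fract_lt_one _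
  have hone := Finset.sum_sdiff (f := fun _ => (1 : ℝ)) hsub
  simp only [Finset.sum_const, Nat.card_Icc, Nat.add_sub_cancel, nsmul_one] at hone hupp
  rw [← Finset.sum_sdiff hsub]
  constructor <;> linarith [hm.1, hm.2]
end

section
/- Let V be a complex vector space, e ≥ 1 an integer, and V_0, …, V_{e−1} subspaces of V forming an internal direct sum decomposition V = V_0 ⊕ … ⊕ V_{e−1}. Let T : V → V be a ℂ-linear map with T(V_k) ⊆ V_{k+1} for 0 ≤ k ≤ e − 2 and T(V_{e−1}) ⊆ V_0. Then T^e(V_0) ⊆ V_0, and for every nonzero q ∈ ℂ the projection of V onto V_0 (along V_1 ⊕ … ⊕ V_{e−1}) restricts to a ℂ-linear isomorphism from the eigenspace ker(T − q·id_V) onto the eigenspace ker((T^e)|_{V_0} − q^e·id_{V_0}). -/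
open DirectSum

/-- An additive map of degree one commutes with taking homogeneous components. -/
theorem decompose_map_add_one {R V ι : Type*} [Semiring R] [AddCommGroup V] [Module R V]
    [DecidableEq ι] [AddGroup ι] [One ι] (W : ι → Submodule R V) [Decomposition W]
    {T : V →ₗ[R] V} (hT : ∀ k, ∀ v ∈ W k, T v ∈ W (k + 1)) (x : V) (k : ι) :
    (decompose W (T x) (k + 1) : V) = T (decompose W x k) := by
  induction x using Decomposition.inductionOn W with
  | zero => simp
  | @homogeneous i m =>
    by_cases h : i = k
    · subst h
      rw [decompose_of_mem_same W (hT i m m.2), decompose_of_mem_same W m.2]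
    · rw [decompose_of_mem_ne W (hT i m m.2) (by simpa using h),
        decompose_of_mem_ne W m.2 h, map_zero]
  | add x y hx hy => simp [decompose_add, hx, hy]

/-- A linear map that is the identity on one summand and zero on the others is the component map. -/
theorem eq_decompose_of_projection {R V ι : Type*} [Semiring R] [AddCommGroup V] [Module R V]
    [DecidableEq ι] (W : ι → Submodule R V) [Decomposition W] {i : ι} {π : V →ₗ[R] V}
    (h₁ : ∀ v ∈ W i, π v = v) (h₂ : ∀ k, k ≠ i → ∀ v ∈ W k, π v = 0) (x : V) :
    π x = decompose W x i := by
  induction x using Decomposition.inductionOn W with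
  | zero => simp
  | @homogeneous k m =>
    by_cases h : k = i
    · subst h
      rw [decompose_of_mem_same W m.2, h₁ m m.2]
    · rw [decompose_of_mem_ne W m.2 h, h₂ k h m m.2]
  | add x y hx hy => simp [decompose_add, hx, hy]

theorem pow_apply_mem_natCast {R V ι : Type*} [Semiring R] [AddCommGroup V] [Module R V]
    [AddMonoidWithOne ι] {W : ι → Submodule R V} {T : V →ₗ[R] V}
    (hT : ∀ k, ∀ v ∈ W k, T v ∈ W (k + 1)) {v : V} (hv : v ∈ W 0) (n : ℕ) :
    (T ^ n) v ∈ W (n : ι) := by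
  induction n with
  | zero => simpa using hv
  | succ n ih =>
    rw [pow_succ', Module.End.mul_apply, Nat.cast_succ]
    exact hT _ _ ih

/-- The components of an eigenvector of a degree one map are determined by the zeroth one. -/
theorem pow_decompose_zero_of_eigenvector {R V ι : Type*} [CommSemiring R] [AddCommGroup V]
    [Module R V] [DecidableEq ι] [AddGroupWithOne ι] (W : ι → Submodule R V) [Decomposition W]
    {T : V →ₗ[R] V} (hT : ∀ k, ∀ v ∈ W k, T v ∈ W (k + 1)) {q : R} {x : V}
    (hx : T x = q • x) (n : ℕ) :
    (T ^ n) (decompose W x 0 : V) = q ^ n • (decompose W x (n : ι) : V) := by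
  induction n with
  | zero => rw [Nat.cast_zero, pow_zero, pow_zero, one_smul, Module.End.one_apply]
  | succ n ih =>
    rw [pow_succ', Module.End.mul_apply, ih, map_smul, ← decompose_map_add_one W hT, hx,
      decompose_smul, Nat.cast_succ, pow_succ, mul_smul]
    rfl

/-- The eigenvector built by averaging the orbit of a vector fixed by `q⁻ᵉ Tᵉ`. -/
theorem map_sum_inv_pow_smul {K V : Type*} [Field K] [AddCommGroup V] [Module K V]
    {T : V →ₗ[K] V} {q : K} (hq : q ≠ 0) {e : ℕ} {v : V} (hv : (T ^ e) v = q ^ e • v) :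
    T (∑ k ∈ Finset.range e, q⁻¹ ^ k • (T ^ k) v) =
      q • ∑ k ∈ Finset.range e, q⁻¹ ^ k • (T ^ k) v := by
  have hshift : T (∑ k ∈ Finset.range e, q⁻¹ ^ k • (T ^ k) v) =
      q • ∑ k ∈ Finset.range e, q⁻¹ ^ (k + 1) • (T ^ (k + 1)) v := by
    rw [map_sum, Finset.smul_sum]
    refine Finset.sum_congr rfl fun k _ => ?_
    rw [map_smul, smul_smul, pow_succ' T, Module.End.mul_apply, pow_succ', mul_inv_cancel_left₀ hq]
  have hend : q⁻¹ ^ e • (T ^ e) v = v := by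
    rw [hv, smul_smul, ← mul_pow, inv_mul_cancel₀ hq, one_pow, one_smul]
  have hsum := (Finset.sum_range_succ' (fun k => q⁻¹ ^ k • (T ^ k) v) e).symm.trans
    (Finset.sum_range_succ _ e)
  rw [hend] at hsum
  rw [hshift]
  congr 1
  simpa using hsum


/-- Lemma 3.3 (linear-algebra content): if `T` cyclically permutes the summands of an internal
direct sum decomposition `V = V_0 ⊕ … ⊕ V_{e−1}`, then `T^e` preserves `V_0`, and for every
`q ≠ 0` the projection onto `V_0` restricts to a bijection from the `q`-eigenspace of `T` onto
the `q^e`-eigenspace of `T^e` restricted to `V_0`. -/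
theorem stmt_4 (V : Type*) [AddCommGroup V] [Module ℂ V]
    (e : ℕ) [NeZero e] (W : Fin e → Submodule ℂ V)
    (hW : DirectSum.IsInternal W)
    (T : V →ₗ[ℂ] V)
    (hT : ∀ k : Fin e, ∀ v ∈ W k, T v ∈ W (k + 1))
    (π : V →ₗ[ℂ] V)
    (hπ₁ : ∀ v ∈ W 0, π v = v)
    (hπ₂ : ∀ k : Fin e, k ≠ 0 → ∀ v ∈ W k, π v = 0)
    (q : ℂ) (hq : q ≠ 0) :
    (∀ v ∈ W 0, (T ^ e) v ∈ W 0) ∧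
    Set.BijOn π (LinearMap.ker (T - q • 1) : Set V)
      {v : V | v ∈ W 0 ∧ (T ^ e) v = q ^ e • v} := by
  classical
  open scoped Fin.CommRing in
  let := hW.chooseDecomposition
  have hker (x : V) : x ∈ (LinearMap.ker (T - q • 1) : Set V) ↔ T x = q • x := by
    simp [sub_eq_zero]
  have hcast : ((e : ℕ) : Fin e) = 0 := Fin.natCast_self e
  have hπ := eq_decompose_of_projection W hπ₁ hπ₂
  have hmem {v : V} (hv : v ∈ W 0) : (T ^ e) v ∈ W 0 := by
    simpa [hcast] using pow_apply_mem_natCast hT hv e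
  refine ⟨fun v hv => hmem hv, fun x hx => ?_, fun x hx y hy hxy => ?_, fun v ⟨hv, hv'⟩ => ?_⟩
  · rw [hker] at hx
    have h := pow_decompose_zero_of_eigenvector W hT hx e
    rw [hcast] at h
    rw [hπ]
    exact ⟨SetLike.coe_mem _, h⟩
  · rw [hker] at hx hy
    rw [hπ, hπ] at hxy
    apply (decompose W).injective
    ext k
    have hx' := pow_decompose_zero_of_eigenvector W hT hx k
    have hy' := pow_decompose_zero_of_eigenvector W hT hy k
    rw [Fin.cast_val_eq_self] at hx' hy'
    exact smul_right_injective V (pow_ne_zero (k : ℕ) hq) (hx'.symm.trans (hxy ▸ hy'))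
  · refine ⟨_, (hker _).2 (map_sum_inv_pow_smul hq hv'), ?_⟩
    rw [map_sum, Finset.sum_eq_single_of_mem 0 (Finset.mem_range.2 (NeZero.pos e))]
    · simpa using hπ₁ v hv
    · intro k hk hk0
      have hne : (k : Fin e) ≠ 0 := fun h => hk0 <|
        Nat.eq_zero_of_dvd_of_lt ((Fin.natCast_eq_zero).1 h) (Finset.mem_range.1 hk)
      rw [map_smul, hπ₂ _ hne _ (pow_apply_mem_natCast hT hv k), smul_zero]
end

section
/- Let J = diag(1,−1) ∈ M₂(ℂ) and let U(J) = {A ∈ M₂(ℂ) : Aᴴ·J·A = J}, where Aᴴ is the conjugate transpose. Let α, β, γ ∈ U(J) be such that: (i) each of α, β, γ either has finite order or is unipotent (i.e. (A − I)² = 0), and none is a complex scalar multiple of the identity matrix; (ii) there exist nonzero vectors u_α, u_β, u_γ ∈ ℂ² spanning three pairwise distinct complex lines, with α(u_α) ∈ ℂ·u_α, β(u_β) ∈ ℂ·u_β, γ(u_γ) ∈ ℂ·u_γ; (iii) α·β·γ = λ·I for some λ ∈ ℂ. Then the subgroup of U(J) generated by α, β, γ is infinite. -/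
open Matrix

/-- The kernel of a nonzero `2 × 2` matrix is at most one-dimensional. -/
theorem det_eq_zero_of_mulVec_eq_zero {K : Type*} [Field K] {B : Matrix (Fin 2) (Fin 2) K}
    (hB : B ≠ 0) {u v : Fin 2 → K} (hu : B *ᵥ u = 0) (hv : B *ᵥ v = 0) :
    u 0 * v 1 - u 1 * v 0 = 0 := by
  by_contra hd
  refine hB ?_
  have hu' (i : Fin 2) : B i 0 * u 0 + B i 1 * u 1 = 0 := by
    simpa [mulVec, dotProduct, Fin.sum_univ_two] using congrFun hu i
  have hv' (i : Fin 2) : B i 0 * v 0 + B i 1 * v 1 = 0 := by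
    simpa [mulVec, dotProduct, Fin.sum_univ_two] using congrFun hv i
  ext i j
  refine (mul_eq_zero.mp (?_ : (u 0 * v 1 - u 1 * v 0) * B i j = 0)).resolve_left hd
  fin_cases j
  · change _ * B i 0 = 0
    linear_combination v 1 * hu' i - u 1 * hv' i
  · change _ * B i 1 = 0
    linear_combination u 0 * hv' i - v 0 * hu' i

/-- An eigenvector of a non-scalar `2 × 2` matrix is an eigenvector of everything commuting
with that matrix. -/
theorem det_mulVec_eq_zero_of_commute {K : Type*} [Field K] {A T : Matrix (Fin 2) (Fin 2) K}
    (hAT : Commute A T) (hA : ∀ μ : K, A ≠ μ • 1) {u : Fin 2 → K}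
    (hu : ∃ μ : K, A *ᵥ u = μ • u) :
    u 0 * (T *ᵥ u) 1 - u 1 * (T *ᵥ u) 0 = 0 := by
  obtain ⟨μ, hμ⟩ := hu
  refine det_eq_zero_of_mulVec_eq_zero (sub_ne_zero.mpr (hA μ)) ?_ ?_
  · simp [sub_mulVec, smul_mulVec, hμ]
  · rw [sub_mulVec, mulVec_mulVec, hAT.eq, ← mulVec_mulVec, hμ]
    simp [smul_mulVec, mulVec_smul]

/-- Vectors spanning distinct lines of the plane have nonzero determinant. -/
theorem det_ne_zero_of_span_singleton_ne {K : Type*} [Field K] {u v : Fin 2 → K}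
    (hu : u ≠ 0) (hv : v ≠ 0) (huv : Submodule.span K {u} ≠ Submodule.span K {v}) :
    u 0 * v 1 - u 1 * v 0 ≠ 0 := by
  intro hd
  refine huv ?_
  have key : ∀ i, ∀ j, u i * v j = u j * v i := by
    intro i j
    fin_cases i <;> fin_cases j
    · rfl
    · exact sub_eq_zero.mp hd
    · exact (sub_eq_zero.mp hd).symm
    · rfl
  obtain ⟨i, hi⟩ := Function.ne_iff.mp hu
  obtain ⟨j, hj⟩ := Function.ne_iff.mp hv
  simp only [Pi.zero_apply] at hi hj
  have hvi : v i ≠ 0 := fun h => mul_ne_zero hi hj (by rw [key, h, mul_zero])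
  rw [Submodule.span_singleton_eq_span_singleton]
  refine ⟨Units.mk0 (v i / u i) (div_ne_zero hvi hi), ?_⟩
  ext k
  simp only [Units.smul_mk0, Pi.smul_apply, smul_eq_mul]
  field_simp
  linear_combination -key i k

/-- A `2 × 2` matrix with three pairwise independent eigenvectors is scalar. -/
theorem eq_smul_one_of_det_mulVec_eq_zero {K : Type*} [Field K] {T : Matrix (Fin 2) (Fin 2) K}
    {u v w : Fin 2 → K} (huv : u 0 * v 1 - u 1 * v 0 ≠ 0) (hvw : v 0 * w 1 - v 1 * w 0 ≠ 0)
    (huw : u 0 * w 1 - u 1 * w 0 ≠ 0)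
    (hu : u 0 * (T *ᵥ u) 1 - u 1 * (T *ᵥ u) 0 = 0)
    (hv : v 0 * (T *ᵥ v) 1 - v 1 * (T *ᵥ v) 0 = 0)
    (hw : w 0 * (T *ᵥ w) 1 - w 1 * (T *ᵥ w) 0 = 0) :
    T = T 0 0 • 1 := by
  have hd := mul_ne_zero (mul_ne_zero huv hvw) huw
  simp only [mulVec, dotProduct, Fin.sum_univ_two] at hu hv hw
  have h₁₀ : T 1 0 = 0 := by
    refine (mul_eq_zero.mp ?_).resolve_left hd
    linear_combination (v 1 * w 1) * (v 0 * w 1 - v 1 * w 0) * hu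
      - (u 1 * w 1) * (u 0 * w 1 - u 1 * w 0) * hv
      + (u 1 * v 1) * (u 0 * v 1 - u 1 * v 0) * hw
  have h₀₁ : T 0 1 = 0 := by
    refine (mul_eq_zero.mp ?_).resolve_left hd
    linear_combination -((v 0 * w 0) * (v 0 * w 1 - v 1 * w 0) * hu
      - (u 0 * w 0) * (u 0 * w 1 - u 1 * w 0) * hv
      + (u 0 * v 0) * (u 0 * v 1 - u 1 * v 0) * hw)
  have h₁₁ : T 1 1 - T 0 0 = 0 := by
    refine (mul_eq_zero.mp ?_).resolve_left hd
    linear_combination -((v 0 * w 1 + v 1 * w 0) * (v 0 * w 1 - v 1 * w 0) * hu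
      - (u 0 * w 1 + u 1 * w 0) * (u 0 * w 1 - u 1 * w 0) * hv
      + (u 0 * v 1 + u 1 * v 0) * (u 0 * v 1 - u 1 * v 0) * hw)
  ext i j
  fin_cases i <;> fin_cases j <;> simp [h₁₀, h₀₁, sub_eq_zero.mp h₁₁]

open scoped ComplexOrder in
/-- A finite group of matrices preserves a positive definite Hermitian form. -/
theorem exists_posDef_conjTranspose_mul_mul_eq {n : Type*} [Fintype n] [DecidableEq n]
    (G : Subgroup (Matrix n n ℂ)ˣ) [Finite G] :
    ∃ H : Matrix n n ℂ, H.PosDef ∧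
      ∀ g ∈ G, (g : Matrix n n ℂ)ᴴ * H * (g : Matrix n n ℂ) = H := by
  have := Fintype.ofFinite G
  refine ⟨∑ g : G, (g.1 : Matrix n n ℂ)ᴴ * (g.1 : Matrix n n ℂ), ?_, ?_⟩
  · refine Matrix.posDef_sum Finset.univ_nonempty fun g _ => ?_
    exact PosDef.conjTranspose_mul_self _ (mulVec_injective_of_isUnit g.1.isUnit)
  · intro g hg
    rw [Finset.mul_sum, Finset.sum_mul]
    refine Fintype.sum_equiv (Equiv.mulRight (⟨g, hg⟩ : G)) _ _ fun x => ?_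
    simp [conjTranspose_mul, mul_assoc]

/-- A matrix preserving two forms `H` and `J` commutes with `H⁻¹ * J`. -/
theorem commute_inv_mul_of_conjTranspose_mul_mul_eq {n : Type*} [Fintype n] [DecidableEq n]
    {H J : Matrix n n ℂ} (hH : IsUnit H) (g : (Matrix n n ℂ)ˣ)
    (hgH : (g : Matrix n n ℂ)ᴴ * H * (g : Matrix n n ℂ) = H)
    (hgJ : (g : Matrix n n ℂ)ᴴ * J * (g : Matrix n n ℂ) = J) :
    Commute (g : Matrix n n ℂ) (H⁻¹ * J) := by
  have hdet : IsUnit H.det := (isUnit_iff_isUnit_det H).mp hH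
  have hg : IsUnit ((g : Matrix n n ℂ)ᴴ) := g.isUnit.star
  refine hH.mul_left_cancel (hg.mul_left_cancel ?_)
  calc (g : Matrix n n ℂ)ᴴ * (H * (g * (H⁻¹ * J)))
      = ((g : Matrix n n ℂ)ᴴ * H * g) * (H⁻¹ * J) := by simp only [mul_assoc]
    _ = J := by rw [hgH, mul_nonsing_inv_cancel_left _ _ hdet]
    _ = (g : Matrix n n ℂ)ᴴ * (H * (H⁻¹ * J * g)) := by
      rw [mul_assoc H⁻¹, mul_nonsing_inv_cancel_left _ _ hdet, ← mul_assoc, hgJ]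

/-- Infiniteness claim in the proof of Lemma 4.1: three elements of `U(1,1)` as in the lemma
(each of finite order or unipotent, none scalar, fixing three distinct lines, with product a
scalar) generate an infinite subgroup. -/
theorem stmt_7 (J : Matrix (Fin 2) (Fin 2) ℂ) (hJ : J = Matrix.diagonal ![1, -1])
    (α β γ : (Matrix (Fin 2) (Fin 2) ℂ)ˣ)
    (hαJ : (↑α : Matrix (Fin 2) (Fin 2) ℂ)ᴴ * J * (↑α : Matrix (Fin 2) (Fin 2) ℂ) = J)
    (hβJ : (↑β : Matrix (Fin 2) (Fin 2) ℂ)ᴴ * J * (↑β : Matrix (Fin 2) (Fin 2) ℂ) = J)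
    (hγJ : (↑γ : Matrix (Fin 2) (Fin 2) ℂ)ᴴ * J * (↑γ : Matrix (Fin 2) (Fin 2) ℂ) = J)
    -- (i): finite order or unipotent, and not scalar
    (hα₁ : (∃ p : ℕ, 1 ≤ p ∧ α ^ p = 1) ∨ ((↑α - 1 : Matrix (Fin 2) (Fin 2) ℂ)) ^ 2 = 0)
    (hβ₁ : (∃ p : ℕ, 1 ≤ p ∧ β ^ p = 1) ∨ ((↑β - 1 : Matrix (Fin 2) (Fin 2) ℂ)) ^ 2 = 0)
    (hγ₁ : (∃ p : ℕ, 1 ≤ p ∧ γ ^ p = 1) ∨ ((↑γ - 1 : Matrix (Fin 2) (Fin 2) ℂ)) ^ 2 = 0)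
    (hα₂ : ∀ μ : ℂ, (↑α : Matrix (Fin 2) (Fin 2) ℂ) ≠ μ • 1)
    (hβ₂ : ∀ μ : ℂ, (↑β : Matrix (Fin 2) (Fin 2) ℂ) ≠ μ • 1)
    (hγ₂ : ∀ μ : ℂ, (↑γ : Matrix (Fin 2) (Fin 2) ℂ) ≠ μ • 1)
    -- (ii): three distinct fixed lines
    (uα uβ uγ : Fin 2 → ℂ) (huα : uα ≠ 0) (huβ : uβ ≠ 0) (huγ : uγ ≠ 0)
    (hαβ : Submodule.span ℂ {uα} ≠ Submodule.span ℂ {uβ})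
    (hβγ : Submodule.span ℂ {uβ} ≠ Submodule.span ℂ {uγ})
    (hαγ : Submodule.span ℂ {uα} ≠ Submodule.span ℂ {uγ})
    (hfixα : ∃ μ : ℂ, (↑α : Matrix (Fin 2) (Fin 2) ℂ) *ᵥ uα = μ • uα)
    (hfixβ : ∃ μ : ℂ, (↑β : Matrix (Fin 2) (Fin 2) ℂ) *ᵥ uβ = μ • uβ)
    (hfixγ : ∃ μ : ℂ, (↑γ : Matrix (Fin 2) (Fin 2) ℂ) *ᵥ uγ = μ • uγ)
    -- (iii): the product is scalar
    (hprod : ∃ lam : ℂ, (↑(α * β * γ) : Matrix (Fin 2) (Fin 2) ℂ) = lam • 1) :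
    Set.Infinite ((Subgroup.closure {α, β, γ} :
      Subgroup (Matrix (Fin 2) (Fin 2) ℂ)ˣ) : Set (Matrix (Fin 2) (Fin 2) ℂ)ˣ) := by
  intro hfin
  have : Finite (Subgroup.closure {α, β, γ}) := hfin
  obtain ⟨H, hH, hinv⟩ :=
    exists_posDef_conjTranspose_mul_mul_eq (Subgroup.closure {α, β, γ})
  have hunit : IsUnit H := open scoped ComplexOrder in hH.isUnit
  have hdet : IsUnit H.det := (isUnit_iff_isUnit_det H).mp hunit
  have hscalar := eq_smul_one_of_det_mulVec_eq_zero (T := H⁻¹ * J)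
    (det_ne_zero_of_span_singleton_ne huα huβ hαβ) (det_ne_zero_of_span_singleton_ne huβ huγ hβγ)
    (det_ne_zero_of_span_singleton_ne huα huγ hαγ)
    (det_mulVec_eq_zero_of_commute (commute_inv_mul_of_conjTranspose_mul_mul_eq hunit α
      (hinv α (Subgroup.subset_closure (by simp))) hαJ) hα₂ hfixα)
    (det_mulVec_eq_zero_of_commute (commute_inv_mul_of_conjTranspose_mul_mul_eq hunit β
      (hinv β (Subgroup.subset_closure (by simp))) hβJ) hβ₂ hfixβ)
    (det_mulVec_eq_zero_of_commute (commute_inv_mul_of_conjTranspose_mul_mul_eq hunit γ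
      (hinv γ (Subgroup.subset_closure (by simp))) hγJ) hγ₂ hfixγ)
  generalize (H⁻¹ * J) 0 0 = c at hscalar
  have hJH : J = c • H := by
    rw [← mul_nonsing_inv_cancel_left H J hdet, hscalar, mul_smul_comm, mul_one]
  have h₀ : (1 : ℂ) = c * H 0 0 := by simpa [hJ] using congrFun (congrFun hJH 0) 0
  have h₁ : (-1 : ℂ) = c * H 1 1 := by simpa [hJ] using congrFun (congrFun hJH 1) 1
  have hsum : H 0 0 + H 1 1 = 0 := by linear_combination H 1 1 * h₀ - H 0 0 * h₁
  open scoped ComplexOrder in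
  exact (add_pos (hH.diag_pos (i := 0)) (hH.diag_pos (i := 1))).ne' hsum
end

section
/- Let J = diag(1,−1) ∈ M₂(ℂ), U(J) = {A ∈ M₂(ℂ) : Aᴴ·J·A = J} and SU(J) = {A ∈ U(J) : det A = 1}. Let α, β, γ ∈ U(J) be such that: (i) each of α, β, γ either has finite order or is unipotent (i.e. (A − I)² = 0), and none is a complex scalar multiple of the identity matrix; (ii) there exist nonzero vectors u_α, u_β, u_γ ∈ ℂ² spanning three pairwise distinct complex lines, with α(u_α) ∈ ℂ·u_α, β(u_β) ∈ ℂ·u_β, γ(u_γ) ∈ ℂ·u_γ; (iii) α·β·γ = λ·I for some λ ∈ ℂ. Then every subgroup H of SU(J) whose underlying set is closed and connected in M₂(ℂ) and which is normalized by each of α, β, γ (that is, δ·H·δ⁻¹ = H for δ ∈ {α, β, γ}) satisfies H = {I} or H = SU(J). -/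
open Matrix Filter Topology ComplexConjugate

local notation "M₂" => Matrix (Fin 2) (Fin 2) ℂ

/-- The Lie algebra of `SU(1,1)`. -/
def IsLieSU11 (X : M₂) : Prop :=
  X 1 1 = conj (X 0 0) ∧ X 1 0 = conj (X 0 1) ∧ X 1 1 = -X 0 0

/-- The indefinite form on `ℂ²` given by `diag(1,-1)`. -/
def form11 (x y : Fin 2 → ℂ) : ℂ := conj (x 0) * y 0 - conj (x 1) * y 1

lemma exists_smul_of_cross_eq_zero {u w : Fin 2 → ℂ} (hu : u ≠ 0)
    (h : u 0 * w 1 - u 1 * w 0 = 0) : ∃ c : ℂ, w = c • u := by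
  by_cases h0 : u 0 = 0
  · have h1 : u 1 ≠ 0 := by
      intro h1
      apply hu
      ext i
      fin_cases i <;> simp [h0, h1]
    refine ⟨w 1 / u 1, ?_⟩
    have hw : w 0 = 0 := by simpa [h0, h1] using h
    ext i
    fin_cases i
    · simp [h0, hw]
    · simp [h1]
  · refine ⟨w 0 / u 0, ?_⟩
    ext i
    fin_cases i
    · simp [h0]
    · simp only [Fin.mk_one, Pi.smul_apply, smul_eq_mul]
      field_simp
      linear_combination h

lemma mulVec_fin_two (A : M₂) (u : Fin 2 → ℂ) (μ : ℂ) :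
    A *ᵥ u = μ • u ↔
      A 0 0 * u 0 + A 0 1 * u 1 = μ * u 0 ∧ A 1 0 * u 0 + A 1 1 * u 1 = μ * u 1 := by
  simp [funext_iff, Fin.forall_fin_two]

lemma exists_smul_of_eigenvalue_eq {A : M₂} (hA : ∀ μ : ℂ, A ≠ μ • 1) {u w : Fin 2 → ℂ} {μ : ℂ}
    (hu : u ≠ 0) (hAu : A *ᵥ u = μ • u) (hAw : A *ᵥ w = μ • w) : ∃ c : ℂ, w = c • u := by
  apply exists_smul_of_cross_eq_zero hu
  by_contra hne
  rw [mulVec_fin_two] at hAu hAw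
  obtain ⟨h1, h2⟩ := hAu
  obtain ⟨h3, h4⟩ := hAw
  apply hA μ
  ext i j
  fin_cases i <;> fin_cases j <;> simp <;> apply mul_right_cancel₀ hne
  · linear_combination w 1 * h1 - u 1 * h3
  · linear_combination u 0 * h3 - w 0 * h1
  · linear_combination w 1 * h2 - u 1 * h4
  · linear_combination u 0 * h4 - w 0 * h2

lemma span_eq_of_smul {u v w : Fin 2 → ℂ} (hu : u ≠ 0) (hw : w ≠ 0)
    (h1 : ∃ c : ℂ, u = c • v) (h2 : ∃ c : ℂ, w = c • v) :
    Submodule.span ℂ {u} = Submodule.span ℂ {w} := by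
  obtain ⟨c, rfl⟩ := h1
  obtain ⟨d, rfl⟩ := h2
  rw [Submodule.span_singleton_smul_eq (IsUnit.mk0 c (left_ne_zero_of_smul hu)),
    Submodule.span_singleton_smul_eq (IsUnit.mk0 d (left_ne_zero_of_smul hw))]

lemma norm_eigenvalue_eq_one {A : M₂} (hA : (∃ p : ℕ, 1 ≤ p ∧ A ^ p = 1) ∨ (A - 1) ^ 2 = 0)
    {u : Fin 2 → ℂ} {μ : ℂ} (hu : u ≠ 0) (hAu : A *ᵥ u = μ • u) : ‖μ‖ = 1 := by
  rcases hA with ⟨p, hp, hAp⟩ | hA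
  · have key : ∀ n : ℕ, A ^ n *ᵥ u = μ ^ n • u := by
      intro n
      induction n with
      | zero => simp
      | succ n ih => rw [pow_succ, ← mulVec_mulVec, hAu, mulVec_smul, ih, smul_smul, pow_succ']
    have h := key p
    rw [hAp, one_mulVec] at h
    refine Complex.norm_eq_one_of_pow_eq_one (n := p) ?_ (by omega)
    exact (smul_left_injective ℂ hu (by simpa using h)).symm
  · have h1 : (A - 1) *ᵥ u = (μ - 1) • u := by rw [sub_mulVec, hAu, one_mulVec, sub_smul, one_smul]
    have h2 : (A - 1) ^ 2 *ᵥ u = ((μ - 1) * (μ - 1)) • u := by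
      rw [pow_two, ← mulVec_mulVec, h1, mulVec_smul, h1, smul_smul]
    rw [hA, zero_mulVec] at h2
    have h3 := (smul_eq_zero.mp h2.symm).resolve_right hu
    have h4 : μ = 1 := by simpa [sub_eq_zero] using h3
    simp [h4]

lemma form11_mulVec {A : M₂} (hA : Aᴴ * diagonal ![1, -1] * A = diagonal ![1, -1])
    (x y : Fin 2 → ℂ) : form11 (A *ᵥ x) (A *ᵥ y) = form11 x y := by
  have key : ∀ x y : Fin 2 → ℂ, form11 x y = star x ⬝ᵥ (diagonal ![1, -1] : M₂) *ᵥ y := by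
    intro x y
    simp [form11, dotProduct, Fin.sum_univ_two, mulVec_diagonal]
    ring
  rw [key, key, star_mulVec, ← dotProduct_mulVec, mulVec_mulVec, mulVec_mulVec, hA]

lemma exists_smul_of_isotropic {A : M₂} (hA : Aᴴ * diagonal ![1, -1] * A = diagonal ![1, -1])
    (hA₁ : (∃ p : ℕ, 1 ≤ p ∧ A ^ p = 1) ∨ (A - 1) ^ 2 = 0) (hA₂ : ∀ μ : ℂ, A ≠ μ • 1)
    {v w : Fin 2 → ℂ} {μ ν : ℂ} (hv : v ≠ 0) (hv0 : form11 v v = 0)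
    (hAv : A *ᵥ v = μ • v) (hAw : A *ᵥ w = ν • w) : ∃ c : ℂ, w = c • v := by
  have h1 := form11_mulVec hA v w
  rw [hAv, hAw] at h1
  have hμ := norm_eigenvalue_eq_one hA₁ hv hAv
  have hμ' : conj μ * μ = 1 := by rw [Complex.conj_mul', hμ]; simp
  by_cases h0 : form11 v w = 0
  · apply exists_smul_of_cross_eq_zero hv
    have hv1 : conj (v 1) ≠ 0 := by
      intro h
      apply hv
      have h1 : v 1 = 0 := by simpa using h
      have h2 : v 0 = 0 := by simpa [form11, h1] using hv0
      ext i
      fin_cases i <;> simp [h1, h2]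
    apply mul_left_cancel₀ hv1
    simp only [form11] at hv0 h0
    linear_combination w 0 * hv0 - v 0 * h0
  · have h2 : conj μ * ν = 1 := by
      apply mul_right_cancel₀ h0
      simp only [form11, Pi.smul_apply, smul_eq_mul, map_mul] at h1 ⊢
      linear_combination h1
    have h3 : ν = μ := by linear_combination μ * h2 - ν * hμ'
    exact exists_smul_of_eigenvalue_eq hA₂ hv hAv (h3 ▸ hAw)

/-- Traceless matrices commuting with a nonzero traceless `2 × 2` matrix are proportional to it. -/
lemma exists_smul_of_commute {Y Z : M₂} (hY : Y 1 1 = -Y 0 0) (hZ : Z 1 1 = -Z 0 0) (hY0 : Y ≠ 0)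
    (h : Y * Z = Z * Y) : ∃ a : ℂ, Z = a • Y := by
  have h00 := congrFun₂ h 0 0
  have h01 := congrFun₂ h 0 1
  have h10 := congrFun₂ h 1 0
  simp only [mul_apply, Fin.sum_univ_two, hY, hZ] at h00 h01 h10
  have key : ∀ k : ℂ, k ≠ 0 → ∀ l : ℂ, Z 0 0 * k = l * Y 0 0 → Z 0 1 * k = l * Y 0 1 →
      Z 1 0 * k = l * Y 1 0 → ∃ a : ℂ, Z = a • Y := by
    intro k hk l e1 e2 e3
    refine ⟨l / k, ?_⟩
    ext i j
    fin_cases i <;> fin_cases j <;> simp [hY, hZ] <;> field_simp <;> assumption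
  by_cases y0 : Y 0 0 = 0
  · by_cases y1 : Y 0 1 = 0
    · by_cases y2 : Y 1 0 = 0
      · exact absurd (by ext i j; fin_cases i <;> fin_cases j <;> simp [*]) hY0
      · refine key _ y2 (Z 1 0) ?_ ?_ ?_
        · linear_combination h10 / 2
        · linear_combination -h00
        · ring
    · refine key _ y1 (Z 0 1) ?_ ?_ ?_
      · linear_combination -h01 / 2
      · ring
      · linear_combination h00
  · refine key _ y0 (Z 0 0) ?_ ?_ ?_
    · ring
    · linear_combination h01 / 2
    · linear_combination -h10 / 2

lemma ne_smul_one_of_traceless {Y : M₂} (hY : Y 1 1 = -Y 0 0) (hY0 : Y ≠ 0) (μ : ℂ) :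
    Y ≠ μ • 1 := by
  rintro rfl
  simp only [Matrix.smul_apply, one_apply_eq, smul_eq_mul, mul_one] at hY
  have : μ = 0 := by linear_combination hY / 2
  simp [this] at hY0

/-- An element of `U(1,1)` cannot anticommute with an elliptic element of the Lie algebra. -/
lemma not_anticommute_of_elliptic {A Y : M₂}
    (hA : Aᴴ * diagonal ![1, -1] * A = diagonal ![1, -1]) {s : ℝ} {b : ℂ}
    (hY : Y = !![Complex.I * s, b; conj b, -(Complex.I * s)])
    (hs : ‖b‖ ^ 2 - s ^ 2 < 0) : A * Y ≠ (-1 : ℂ) • (Y * A) := by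
  intro h
  have h1 := form11_mulVec hA ![1, 0] (Y *ᵥ ![1, 0])
  rw [mulVec_mulVec, h, smul_mulVec, ← mulVec_mulVec] at h1
  set x := A *ᵥ ![1, 0]
  have e1 : Complex.I * form11 ![1, 0] (Y *ᵥ ![1, 0]) = -s := by
    simp [form11, hY, mulVec, dotProduct, Fin.sum_univ_two]
    linear_combination (s : ℂ) * Complex.I_mul_I
  have e2 : (Complex.I * form11 x (Y *ᵥ x)).re
      = -s * (‖x 0‖ ^ 2 + ‖x 1‖ ^ 2) - 2 * (b * conj (x 0) * x 1).im := by
    rw [← Complex.normSq_eq_norm_sq, ← Complex.normSq_eq_norm_sq]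
    simp [form11, hY, mulVec, dotProduct, Fin.sum_univ_two, Complex.normSq_apply]
    ring
  have e3 : (Complex.I * form11 x (Y *ᵥ x)).re = s := by
    have : Complex.I * form11 x (Y *ᵥ x) = s := by
      rw [← neg_eq_iff_eq_neg.mpr e1, ← h1]
      simp [form11]
      ring
    rw [this, Complex.ofReal_re]
  rw [e2] at e3
  have e4 : |(b * conj (x 0) * x 1).im| ≤ ‖b‖ * ‖x 0‖ * ‖x 1‖ := by
    simpa using Complex.abs_im_le_norm (b * conj (x 0) * x 1)
  have hb : ‖b‖ < |s| := by
    rw [← abs_of_nonneg (norm_nonneg b), ← sq_lt_sq]; linarith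
  have e5 : 2 * (‖b‖ * ‖x 0‖ * ‖x 1‖) ≤ |s| * (‖x 0‖ ^ 2 + ‖x 1‖ ^ 2) := by
    nlinarith [mul_nonneg (abs_nonneg s) (sq_nonneg (‖x 0‖ - ‖x 1‖)),
      mul_nonneg (sub_nonneg.2 hb.le) (mul_nonneg (norm_nonneg (x 0)) (norm_nonneg (x 1)))]
  rw [abs_le] at e4
  have hspos := (norm_nonneg b).trans_lt hb
  rcases abs_cases s with ⟨h, _⟩ | ⟨h, _⟩ <;> rw [h] at e5 hspos <;> nlinarith

/-- A matrix normalising the line spanned by `Y` acts on it by a sign if `Y` is invertible. -/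
lemma sq_eq_one_of_normalizes {A Y : M₂} (hA : A.det ≠ 0) (hY : Y.det ≠ 0) {a : ℂ}
    (h : A * Y = a • (Y * A)) : a = 1 ∨ a = -1 := by
  have h1 := congrArg det h
  rw [det_smul, det_mul, det_mul, Fintype.card_fin] at h1
  have : a ^ 2 = 1 := by
    apply mul_right_cancel₀ (mul_ne_zero hA hY)
    linear_combination -h1
  exact mul_self_eq_one_iff.mp (by rw [← pow_two, this])

/-- Three non-scalar matrices with three distinct eigenlines do not commute with a common nonzero
traceless matrix. -/
lemma not_all_commute {A B C Y : M₂} (hY : Y 1 1 = -Y 0 0) (hY0 : Y ≠ 0)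
    (hA : ∀ μ : ℂ, A ≠ μ • 1) (hB : ∀ μ : ℂ, B ≠ μ • 1) (hC : ∀ μ : ℂ, C ≠ μ • 1)
    {u v w : Fin 2 → ℂ} (hu : u ≠ 0) (hv : v ≠ 0) (hw : w ≠ 0)
    (huv : Submodule.span ℂ {u} ≠ Submodule.span ℂ {v})
    (hvw : Submodule.span ℂ {v} ≠ Submodule.span ℂ {w})
    (huw : Submodule.span ℂ {u} ≠ Submodule.span ℂ {w})
    (hAu : ∃ μ : ℂ, A *ᵥ u = μ • u) (hBv : ∃ μ : ℂ, B *ᵥ v = μ • v)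
    (hCw : ∃ μ : ℂ, C *ᵥ w = μ • w)
    (hAY : A * Y = Y * A) (hBY : B * Y = Y * B) (hCY : C * Y = Y * C) : False := by
  have key : ∀ {A : M₂} {u : Fin 2 → ℂ}, (∀ μ : ℂ, A ≠ μ • 1) → u ≠ 0 →
      (∃ μ : ℂ, A *ᵥ u = μ • u) → A * Y = Y * A →
      ∃ c : ℂ, Y *ᵥ u = c • u ∧ c ^ 2 = -Y.det := by
    intro A u hA hu ⟨μ, hμ⟩ hAY
    obtain ⟨c, hc⟩ := exists_smul_of_eigenvalue_eq hA hu hμ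
      (w := Y *ᵥ u) (by rw [mulVec_mulVec, hAY, ← mulVec_mulVec, hμ, mulVec_smul])
    refine ⟨c, hc, ?_⟩
    rw [mulVec_fin_two] at hc
    rw [det_fin_two]
    obtain ⟨h1, h2⟩ := hc
    rw [hY] at h2 ⊢
    have : u 0 ≠ 0 ∨ u 1 ≠ 0 := by
      by_contra! h
      exact hu (by ext i; fin_cases i <;> simp [h])
    rcases this with h | h <;> apply mul_right_cancel₀ h
    · linear_combination -(c + Y 0 0) * h1 - Y 0 1 * h2
    · linear_combination -(c - Y 0 0) * h2 - Y 1 0 * h1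
  obtain ⟨a, ha, ha2⟩ := key hA hu hAu hAY
  obtain ⟨b, hb, hb2⟩ := key hB hv hBv hBY
  obtain ⟨c, hc, hc2⟩ := key hC hw hCw hCY
  have hYs := ne_smul_one_of_traceless hY hY0
  have hab : a ≠ b := by
    rintro rfl
    exact huv (span_eq_of_smul hu hv ⟨1, (one_smul _ _).symm⟩
      (exists_smul_of_eigenvalue_eq hYs hu ha hb))
  have hbc : b ≠ c := by
    rintro rfl
    exact hvw (span_eq_of_smul hv hw ⟨1, (one_smul _ _).symm⟩
      (exists_smul_of_eigenvalue_eq hYs hv hb hc))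
  have hac : a ≠ c := by
    rintro rfl
    exact huw (span_eq_of_smul hu hw ⟨1, (one_smul _ _).symm⟩
      (exists_smul_of_eigenvalue_eq hYs hu ha hc))
  have h1 : a = -b := (sq_eq_sq_iff_eq_or_eq_neg.mp (ha2.trans hb2.symm)).resolve_left hab
  have h2 : c = -b := (sq_eq_sq_iff_eq_or_eq_neg.mp (hc2.trans hb2.symm)).resolve_left hbc.symm
  exact hac (h1.trans h2.symm)

/-- An element of `U(1,1)` that is non-scalar and of finite order or unipotent does not commute
with a hyperbolic element of the Lie algebra. -/
lemma not_commute_of_hyperbolic {A Y : M₂}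
    (hA : Aᴴ * diagonal ![1, -1] * A = diagonal ![1, -1])
    (hA₁ : (∃ p : ℕ, 1 ≤ p ∧ A ^ p = 1) ∨ (A - 1) ^ 2 = 0) (hA₂ : ∀ μ : ℂ, A ≠ μ • 1)
    {δ : ℂ} (hδ : δ ≠ 0) (hYs : ∀ μ : ℂ, Y ≠ μ • 1) {v w : Fin 2 → ℂ} (hv : v ≠ 0)
    (hw : w ≠ 0) (hv0 : form11 v v = 0) (hYv : Y *ᵥ v = δ • v) (hYw : Y *ᵥ w = (-δ) • w) :
    A * Y ≠ Y * A := by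
  intro h
  have key : ∀ {ε : ℂ} {v : Fin 2 → ℂ}, v ≠ 0 → Y *ᵥ v = ε • v → ∃ c : ℂ, A *ᵥ v = c • v := by
    intro ε v hv hYv
    exact exists_smul_of_eigenvalue_eq hYs hv hYv
      (by rw [mulVec_mulVec, ← h, ← mulVec_mulVec, hYv, mulVec_smul])
  obtain ⟨μ, hμ⟩ := key hv hYv
  obtain ⟨ν, hν⟩ := key hw hYw
  obtain ⟨c, rfl⟩ := exists_smul_of_isotropic hA hA₁ hA₂ hv hv0 hμ hν
  rw [mulVec_smul, hYv, smul_smul, smul_smul] at hYw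
  have h1 := smul_left_injective ℂ hv hYw
  have hc : c ≠ 0 := left_ne_zero_of_smul hw
  have h2 : (2 * δ) * c = 0 := by linear_combination h1
  simp [hδ, hc] at h2

lemma IsLieSU11.exists_eq {Y : M₂} (hY : IsLieSU11 Y) :
    ∃ (s : ℝ) (b : ℂ), Y = !![Complex.I * s, b; conj b, -(Complex.I * s)] := by
  obtain ⟨h1, h2, h3⟩ := hY
  have h00 : Y 0 0 = Complex.I * ((Y 0 0).im : ℝ) := by
    have := congrArg Complex.re (h1.symm.trans h3)
    simp at this
    apply Complex.ext <;> simp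
    linarith
  refine ⟨(Y 0 0).im, Y 0 1, ?_⟩
  rw [← h00]
  ext i j
  fin_cases i <;> fin_cases j <;> simp [h2, h3]

/-- No line in the Lie algebra of `SU(1,1)` is normalised by three non-scalar elements of `U(1,1)`
of finite order or unipotent, with distinct eigenlines and scalar product. -/
lemma no_normalized_line {A B C Y : M₂} (hY : IsLieSU11 Y) (hY0 : Y ≠ 0)
    (hA : Aᴴ * diagonal ![1, -1] * A = diagonal ![1, -1])
    (hB : Bᴴ * diagonal ![1, -1] * B = diagonal ![1, -1])
    (hC : Cᴴ * diagonal ![1, -1] * C = diagonal ![1, -1])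
    (hA₁ : (∃ p : ℕ, 1 ≤ p ∧ A ^ p = 1) ∨ (A - 1) ^ 2 = 0)
    (hB₁ : (∃ p : ℕ, 1 ≤ p ∧ B ^ p = 1) ∨ (B - 1) ^ 2 = 0)
    (hC₁ : (∃ p : ℕ, 1 ≤ p ∧ C ^ p = 1) ∨ (C - 1) ^ 2 = 0)
    (hA₂ : ∀ μ : ℂ, A ≠ μ • 1) (hB₂ : ∀ μ : ℂ, B ≠ μ • 1) (hC₂ : ∀ μ : ℂ, C ≠ μ • 1)
    {u v w : Fin 2 → ℂ} (hu : u ≠ 0) (hv : v ≠ 0) (hw : w ≠ 0)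
    (huv : Submodule.span ℂ {u} ≠ Submodule.span ℂ {v})
    (hvw : Submodule.span ℂ {v} ≠ Submodule.span ℂ {w})
    (huw : Submodule.span ℂ {u} ≠ Submodule.span ℂ {w})
    (hAu : ∃ μ : ℂ, A *ᵥ u = μ • u) (hBv : ∃ μ : ℂ, B *ᵥ v = μ • v)
    (hCw : ∃ μ : ℂ, C *ᵥ w = μ • w)
    {l : ℂ} (hl : A * B * C = l • 1) {a b c : ℂ}
    (ha : A * Y = a • (Y * A)) (hb : B * Y = b • (Y * B)) (hc : C * Y = c • (Y * C)) : False := by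
  have hdet : ∀ {A : M₂}, Aᴴ * diagonal ![1, -1] * A = diagonal ![1, -1] → A.det ≠ 0 := by
    intro A hA h
    have := congrArg det hA
    simp [h] at this
  have hYtr := hY.2.2
  have hYs := ne_smul_one_of_traceless hYtr hY0
  obtain ⟨s, β, hYe⟩ := hY.exists_eq
  have hYdet : Y.det = -((‖β‖ ^ 2 - s ^ 2 : ℝ) : ℂ) := by
    rw [hYe, det_fin_two_of, Complex.mul_conj']
    push_cast
    linear_combination -(s : ℂ) ^ 2 * Complex.I_sq
  have habc : a * b * c = 1 := by
    have h1 : A * B * C * Y = (a * b * c) • (Y * (A * B * C)) := by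
      calc A * B * C * Y = A * (B * (C * Y)) := by noncomm_ring
        _ = c • (A * (B * Y) * C) := by rw [hc]; simp [mul_assoc]
        _ = (c * b) • (A * Y * B * C) := by rw [hb]; simp [mul_assoc, smul_smul]
        _ = _ := by rw [ha]; simp only [smul_mul_assoc, smul_smul, mul_assoc]; congr 1; ring
    rw [hl] at h1
    have hl0 : l ≠ 0 := by
      rintro rfl
      have := congrArg det hl
      simp [hdet hA, hdet hB, hdet hC] at this
    have h2 : l • Y = (a * b * c * l) • Y := by simpa [smul_smul] using h1
    have h3 := smul_left_injective ℂ hY0 h2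
    apply mul_right_cancel₀ hl0
    linear_combination -h3
  rcases lt_or_ge (‖β‖ ^ 2 - s ^ 2) 0 with hneg | hnonneg
  · have hYd : Y.det ≠ 0 := by
      rw [hYdet]
      exact_mod_cast neg_ne_zero.2 hneg.ne
    have key : ∀ {A : M₂} {a : ℂ}, Aᴴ * diagonal ![1, -1] * A = diagonal ![1, -1] →
        A * Y = a • (Y * A) → A * Y = Y * A := by
      intro A a hA ha
      rcases sq_eq_one_of_normalizes (hdet hA) hYd ha with rfl | rfl
      · simpa using ha
      · exact absurd ha (not_anticommute_of_elliptic hA hYe hneg)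
    exact not_all_commute hYtr hY0 hA₂ hB₂ hC₂ hu hv hw huv hvw huw hAu hBv hCw
      (key hA ha) (key hB hb) (key hC hc)
  · obtain ⟨δ, hδ⟩ : ∃ δ : ℝ, δ ^ 2 = ‖β‖ ^ 2 - s ^ 2 := ⟨_, Real.sq_sqrt hnonneg⟩
    have hβ : β ≠ 0 := by
      rintro rfl
      have hs : s = 0 := by
        simp at hnonneg
        nlinarith
      apply hY0
      rw [hYe, hs]
      ext i j
      fin_cases i <;> fin_cases j <;> simp
    have hββ : β * conj β = (δ : ℂ) ^ 2 + (s : ℂ) ^ 2 := by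
      rw [Complex.mul_conj']
      have : ‖β‖ ^ 2 = δ ^ 2 + s ^ 2 := by linarith
      exact_mod_cast this
    have hvec : ∀ δ : ℝ, β * conj β = (δ : ℂ) ^ 2 + (s : ℂ) ^ 2 →
        ![β, δ - Complex.I * s] ≠ 0 ∧
        form11 ![β, δ - Complex.I * s] ![β, δ - Complex.I * s] = 0 ∧
        Y *ᵥ ![β, δ - Complex.I * s] = (δ : ℂ) • ![β, δ - Complex.I * s] := by
      intro δ hδ
      refine ⟨fun h => hβ (congrFun h 0), ?_, ?_⟩
      · simp [form11]
        linear_combination hδ + (s : ℂ) ^ 2 * Complex.I_sq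
      · rw [mulVec_fin_two, hYe]
        constructor <;> simp
        · ring
        · linear_combination hδ + (s : ℂ) ^ 2 * Complex.I_sq
    obtain ⟨hp0, hpi, hpe⟩ := hvec δ hββ
    obtain ⟨hm0, -, hme⟩ := hvec (-δ) (by push_cast; linear_combination hββ)
    by_cases hδ0 : δ = 0
    · set p : Fin 2 → ℂ := ![β, δ - Complex.I * s]
      have hpe' : Y *ᵥ p = (0 : ℂ) • p := by rw [hpe, hδ0]; simp
      have key : ∀ {A : M₂} {a : ℂ} {u : Fin 2 → ℂ},
          Aᴴ * diagonal ![1, -1] * A = diagonal ![1, -1] →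
          ((∃ p : ℕ, 1 ≤ p ∧ A ^ p = 1) ∨ (A - 1) ^ 2 = 0) → (∀ μ : ℂ, A ≠ μ • 1) → a ≠ 0 →
          A * Y = a • (Y * A) → (∃ μ : ℂ, A *ᵥ u = μ • u) → ∃ c : ℂ, u = c • p := by
        intro A a u hA hA₁ hA₂ ha0 ha ⟨μ, hμ⟩
        have h1 : a • (Y *ᵥ (A *ᵥ p)) = 0 := by
          rw [mulVec_mulVec, ← smul_mulVec, ← ha, ← mulVec_mulVec, hpe']
          simp
        have h2 := (smul_eq_zero.mp h1).resolve_left ha0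
        obtain ⟨c, hc⟩ := exists_smul_of_eigenvalue_eq hYs hp0 hpe' (w := A *ᵥ p) (by simpa using h2)
        exact exists_smul_of_isotropic hA hA₁ hA₂ hp0 hpi hc hμ
      have ha0 : a ≠ 0 := by rintro rfl; simp at habc
      have hb0 : b ≠ 0 := by rintro rfl; simp at habc
      exact huv (span_eq_of_smul hu hv (key hA hA₁ hA₂ ha0 ha hAu) (key hB hB₁ hB₂ hb0 hb hBv))
    · have hδ0' : (δ : ℂ) ≠ 0 := by exact_mod_cast hδ0
      have hYd : Y.det ≠ 0 := by
        rw [hYdet, ← hδ]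
        simpa using hδ0
      have key : ∀ {A : M₂} {a : ℂ},
          Aᴴ * diagonal ![1, -1] * A = diagonal ![1, -1] →
          ((∃ p : ℕ, 1 ≤ p ∧ A ^ p = 1) ∨ (A - 1) ^ 2 = 0) → (∀ μ : ℂ, A ≠ μ • 1) →
          A * Y = a • (Y * A) → a = -1 := by
        intro A a hA hA₁ hA₂ ha
        refine (sq_eq_one_of_normalizes (hdet hA) hYd ha).resolve_left ?_
        rintro rfl
        exact not_commute_of_hyperbolic hA hA₁ hA₂ hδ0' hYs hp0 hm0 hpi hpe
          (by simpa using hme) (by simpa using ha)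
      rw [key hA hA₁ hA₂ ha, key hB hB₁ hB₂ hb, key hC hC₁ hC₂ hc] at habc
      norm_num at habc

/-- Membership in `SU(1,1)`, in coordinates. -/
def IsSU11 (A : M₂) : Prop :=
  A 1 1 = conj (A 0 0) ∧ A 1 0 = conj (A 0 1) ∧ A.det = 1

lemma isSU11_iff (A : M₂) : IsSU11 A ↔
    Aᴴ * diagonal ![1, -1] * A = diagonal ![1, -1] ∧ A.det = 1 := by
  have key : Aᴴ * diagonal ![1, -1] * A = diagonal ![1, -1] ↔
      (conj (A 0 0) * A 0 0 - conj (A 1 0) * A 1 0 = 1 ∧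
        conj (A 0 0) * A 0 1 - conj (A 1 0) * A 1 1 = 0) ∧
      conj (A 0 1) * A 0 0 - conj (A 1 1) * A 1 0 = 0 ∧
        conj (A 0 1) * A 0 1 - conj (A 1 1) * A 1 1 = -1 := by
    simp [← Matrix.ext_iff, Fin.forall_fin_two, mul_apply, Fin.sum_univ_two, diagonal_apply,
      sub_eq_add_neg]
  rw [key, IsSU11, det_fin_two]
  constructor
  · rintro ⟨h1, h2, h3⟩
    rw [h1, h2] at h3 ⊢
    simp only [Complex.conj_conj]
    refine ⟨⟨⟨?_, ?_⟩, ?_, ?_⟩, h3⟩ <;> first | linear_combination h3 | linear_combination -h3 | ring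
  · rintro ⟨⟨⟨h1, h2⟩, h3, h4⟩, h5⟩
    refine ⟨?_, ?_, h5⟩
    · linear_combination conj (A 0 0) * h5 - A 1 1 * h1 + A 1 0 * h2
    · linear_combination conj (A 0 1) * h5 - A 1 1 * h3 + A 1 0 * h4

/-- A closed subset of a Banach algebra stable under powers and accumulating at `1` contains a
one-parameter semigroup. -/
lemma exists_exp_smul_mem {𝔸 : Type*} [NormedRing 𝔸] [NormedAlgebra ℝ 𝔸] [CompleteSpace 𝔸]
    [ProperSpace 𝔸] {S : Set 𝔸} (hS : IsClosed S) (hpow : ∀ x ∈ S, ∀ n : ℕ, x ^ n ∈ S)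
    (h : ∃ᶠ A in 𝓝 (1 : 𝔸), A ∈ S ∧ A ≠ 1) :
    ∃ X : 𝔸, X ≠ 0 ∧ ∀ t : ℝ, 0 ≤ t → NormedSpace.exp (t • X) ∈ S := by
  let : NormedAlgebra ℚ 𝔸 := NormedAlgebra.restrictScalars ℚ ℝ 𝔸
  have hmap : map NormedSpace.exp (𝓝 (0 : 𝔸)) = 𝓝 1 := by
    have h1 : HasStrictFDerivAt (NormedSpace.exp : 𝔸 → 𝔸)
        ((ContinuousLinearEquiv.refl ℝ 𝔸 : 𝔸 ≃L[ℝ] 𝔸) : 𝔸 →L[ℝ] 𝔸) 0 :=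
      hasStrictFDerivAt_exp_zero
    simpa using h1.map_nhds_eq_of_equiv
  rw [← hmap, frequently_map] at h
  obtain ⟨Z, hZ, hZS⟩ := exists_seq_forall_of_frequently h
  have hZ0 : ∀ n, Z n ≠ 0 := fun n h0 => (hZS n).2 (by rw [h0, NormedSpace.exp_zero])
  have hsph : ∀ n, ‖Z n‖⁻¹ • Z n ∈ Metric.sphere (0 : 𝔸) 1 := by
    intro n
    rw [mem_sphere_zero_iff_norm, norm_smul, norm_inv, norm_norm,
      inv_mul_cancel₀ (norm_ne_zero_iff.2 (hZ0 n))]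
  obtain ⟨X, hX, φ, hφ, hlim⟩ := (isCompact_sphere (0 : 𝔸) 1).tendsto_subseq hsph
  refine ⟨X, ?_, fun t ht => ?_⟩
  · rintro rfl
    simp at hX
  · have hnorm : Tendsto (fun n => ‖Z (φ n)‖⁻¹) atTop atTop := by
      apply Tendsto.inv_tendsto_nhdsGT_zero
      refine tendsto_nhdsWithin_iff.2 ⟨?_, Eventually.of_forall fun n => ?_⟩
      · simpa using (hZ.comp hφ.tendsto_atTop).norm
      · exact norm_pos_iff.2 (hZ0 _)
    have h1 := ((tendsto_nat_floor_mul_div_atTop ht).comp hnorm).smul hlim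
    have h2 := (NormedSpace.exp_continuous.tendsto _).comp h1
    refine hS.mem_of_tendsto h2 (Eventually.of_forall fun n => ?_)
    have h3 : (((⌊t * ‖Z (φ n)‖⁻¹⌋₊ : ℝ) / ‖Z (φ n)‖⁻¹) • ‖Z (φ n)‖⁻¹ • Z (φ n))
        = ⌊t * ‖Z (φ n)‖⁻¹⌋₊ • Z (φ n) := by
      rw [smul_smul, div_mul_cancel₀ _ (inv_ne_zero (norm_ne_zero_iff.2 (hZ0 _))),
        Nat.cast_smul_eq_nsmul]
    simp only [Function.comp_apply]
    rw [h3, NormedSpace.exp_nsmul]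
    exact hpow _ (hZS _).1 _

lemma hasStrictFDerivAt_exp_mul_exp_mul_exp {E 𝔸 : Type*} [NormedAddCommGroup E] [NormedSpace ℝ E]
    [NormedRing 𝔸] [NormedAlgebra ℝ 𝔸] [CompleteSpace 𝔸] (p q r : E →L[ℝ] ℝ) (X Y Z : 𝔸) :
    HasStrictFDerivAt (fun t => NormedSpace.exp (p t • X) * NormedSpace.exp (q t • Y) *
      NormedSpace.exp (r t • Z)) (p.smulRight X + q.smulRight Y + r.smulRight Z) 0 := by
  have hexp : ∀ (p : E →L[ℝ] ℝ) (X : 𝔸), HasStrictFDerivAt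
      (fun t => NormedSpace.exp (p t • X)) (p.smulRight X) 0 := by
    intro p X
    have h0 : HasStrictFDerivAt (NormedSpace.exp : 𝔸 → 𝔸) (1 : 𝔸 →L[ℝ] 𝔸)
        (p.smulRight X 0) := by
      rw [map_zero]
      exact hasStrictFDerivAt_exp_zero
    exact h0.comp (0 : E) (p.smulRight X).hasStrictFDerivAt
  refine (((hexp p X).mul' (hexp q Y)).mul' (hexp r Z)).congr_fderiv ?_
  ext t
  simp
  abel

section Norm

attribute [local instance] Matrix.linftyOpNormedRing Matrix.linftyOpNormedAlgebra

lemma hasDerivAt_exp_smul_apply (X : M₂) (i j : Fin 2) :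
    HasDerivAt (fun t : ℝ => NormedSpace.exp (t • X) i j) (X i j) 0 := by
  have h := hasDerivAt_exp_smul_const (𝕂 := ℝ) X (0 : ℝ)
  simp only [zero_smul, NormedSpace.exp_zero, one_mul] at h
  exact ((entryLinearMap ℝ ℂ i j).toContinuousLinearMap).hasFDerivAt.comp_hasDerivAt (0 : ℝ) h

lemma isLieSU11_of_exp {X : M₂} (h : ∀ t : ℝ, IsSU11 (NormedSpace.exp (t • X))) :
    IsLieSU11 X := by
  have d := hasDerivAt_exp_smul_apply X
  refine ⟨?_, ?_, ?_⟩
  · refine (d 1 1).unique ?_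
    simp_rw [(h _).1]
    exact (d 0 0).star
  · refine (d 1 0).unique ?_
    simp_rw [(h _).2.1]
    exact (d 0 1).star
  · refine (d 1 1).unique ?_
    have h1 := hasDerivAt_exp_smul_apply (-X) 0 0
    refine h1.congr_of_eventuallyEq (Eventually.of_forall fun t => ?_)
    simp only [smul_neg]
    rw [Matrix.exp_neg, inv_def, (h t).2.2, adjugate_fin_two]
    simp

lemma exists_lie_of_frequently {S : Set M₂} (hS : IsClosed S) (hpow : ∀ x ∈ S, ∀ n : ℕ, x ^ n ∈ S)
    (hinv : ∀ x ∈ S, x⁻¹ ∈ S) (hSU : ∀ x ∈ S, IsSU11 x)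
    (h : ∃ᶠ A in 𝓝 (1 : M₂), A ∈ S ∧ A ≠ 1) :
    ∃ X : M₂, X ≠ 0 ∧ IsLieSU11 X ∧ ∀ t : ℝ, NormedSpace.exp (t • X) ∈ S := by
  have : ProperSpace M₂ := FiniteDimensional.proper ℝ M₂
  obtain ⟨X, hX0, hX⟩ := exists_exp_smul_mem hS hpow h
  have hX' : ∀ t : ℝ, NormedSpace.exp (t • X) ∈ S := by
    intro t
    rcases le_total 0 t with ht | ht
    · exact hX t ht
    · have h1 : NormedSpace.exp (t • X) = (NormedSpace.exp ((-t) • X))⁻¹ := by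
        rw [← Matrix.exp_neg, neg_smul, neg_neg]
      rw [h1]
      exact hinv _ (hX (-t) (by linarith))
  exact ⟨X, hX0, isLieSU11_of_exp fun t => hSU _ (hX' t), hX'⟩

/-- The coordinates on `SU(1,1)` near the identity. -/
noncomputable def chart11 : M₂ →L[ℝ] ℝ × ℂ :=
  ((Complex.imLm ∘ₗ entryLinearMap ℝ ℂ 0 0).prod (entryLinearMap ℝ ℂ 0 1)).toContinuousLinearMap

lemma chart11_apply (A : M₂) : chart11 A = ((A 0 0).im, A 0 1) := rfl

lemma IsSU11.eq_of_chart_eq {A B : M₂} (hA : IsSU11 A) (hB : IsSU11 B)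
    (hA0 : 0 < (A 0 0).re) (hB0 : 0 < (B 0 0).re) (h : chart11 A = chart11 B) : A = B := by
  rw [chart11_apply, chart11_apply, Prod.mk.injEq] at h
  obtain ⟨h1, h2⟩ := h
  obtain ⟨a1, a2, a3⟩ := hA
  obtain ⟨b1, b2, b3⟩ := hB
  have h3 : (A 0 0).re = (B 0 0).re := by
    rw [det_fin_two, a1, a2, Complex.mul_conj, Complex.mul_conj] at a3
    rw [det_fin_two, b1, b2, Complex.mul_conj, Complex.mul_conj, ← h2] at b3
    norm_cast at a3 b3
    rw [Complex.normSq_apply, h1] at a3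
    rw [Complex.normSq_apply] at b3
    nlinarith
  have h00 : A 0 0 = B 0 0 := Complex.ext h3 h1
  ext i j
  fin_cases i <;> fin_cases j <;> simp [h00, h2, a1, a2, b1, b2]

lemma IsLieSU11.eq_zero_of_chart {X : M₂} (hX : IsLieSU11 X) (h : chart11 X = 0) : X = 0 := by
  obtain ⟨h1, h2, h3⟩ := hX
  rw [chart11_apply] at h
  have i0 : (X 0 0).im = 0 := congrArg Prod.fst h
  have h01 : X 0 1 = 0 := congrArg Prod.snd h
  have r0 : (X 0 0).re = 0 := by
    have := congrArg Complex.re (h1.symm.trans h3)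
    simp at this
    linarith
  have h00 : X 0 0 = 0 := Complex.ext r0 i0
  ext i j
  fin_cases i <;> fin_cases j <;> simp [h00, h01, h2, h3]

/-- Three one-parameter subgroups in linearly independent directions generate a neighbourhood of
the identity of `SU(1,1)`. -/
lemma eventually_mem_of_basis {S : Set M₂} (hmul : ∀ x ∈ S, ∀ y ∈ S, x * y ∈ S)
    (hSU : ∀ x ∈ S, IsSU11 x) {X₁ X₂ X₃ : M₂}
    (h₁ : ∀ t : ℝ, NormedSpace.exp (t • X₁) ∈ S) (h₂ : ∀ t : ℝ, NormedSpace.exp (t • X₂) ∈ S)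
    (h₃ : ∀ t : ℝ, NormedSpace.exp (t • X₃) ∈ S)
    (hind : ∀ r s t : ℝ, r • X₁ + s • X₂ + t • X₃ = 0 → r = 0 ∧ s = 0 ∧ t = 0) :
    ∀ᶠ A in 𝓝 (1 : M₂), IsSU11 A → A ∈ S := by
  have hlie : ∀ {X : M₂}, (∀ t : ℝ, NormedSpace.exp (t • X) ∈ S) → IsLieSU11 X :=
    fun h => isLieSU11_of_exp fun t => hSU _ (h t)
  let p₁ : ℝ × ℝ × ℝ →L[ℝ] ℝ := .fst ℝ _ _
  let p₂ : ℝ × ℝ × ℝ →L[ℝ] ℝ := (ContinuousLinearMap.fst ℝ ℝ ℝ).comp (.snd ℝ _ _)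
  let p₃ : ℝ × ℝ × ℝ →L[ℝ] ℝ := (ContinuousLinearMap.snd ℝ ℝ ℝ).comp (.snd ℝ _ _)
  let G : ℝ × ℝ × ℝ → M₂ := fun t =>
    NormedSpace.exp (p₁ t • X₁) * NormedSpace.exp (p₂ t • X₂) * NormedSpace.exp (p₃ t • X₃)
  have hG0 : G 0 = 1 := by simp [G]
  have hG : HasStrictFDerivAt G (p₁.smulRight X₁ + p₂.smulRight X₂ + p₃.smulRight X₃) 0 :=
    hasStrictFDerivAt_exp_mul_exp_mul_exp p₁ p₂ p₃ X₁ X₂ X₃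
  have hF := chart11.hasStrictFDerivAt.comp (0 : ℝ × ℝ × ℝ) hG
  set L := chart11.comp (p₁.smulRight X₁ + p₂.smulRight X₂ + p₃.smulRight X₃)
  have hL : ∀ t : ℝ × ℝ × ℝ, L t = chart11 (t.1 • X₁ + t.2.1 • X₂ + t.2.2 • X₃) := by
    intro t
    rfl
  have hinj : Function.Injective L := by
    rw [injective_iff_map_eq_zero]
    rintro ⟨r, s, t⟩ h
    rw [hL] at h
    obtain ⟨a1, a2, a3⟩ := hlie h₁
    obtain ⟨b1, b2, b3⟩ := hlie h₂
    obtain ⟨c1, c2, c3⟩ := hlie h₃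
    have h4 : IsLieSU11 (r • X₁ + s • X₂ + t • X₃) := by
      refine ⟨?_, ?_, ?_⟩
      · simp [a1, b1, c1]
      · simp [a2, b2, c2]
      · simp [a3, b3, c3]; ring
    obtain ⟨rfl, rfl, rfl⟩ := hind r s t (h4.eq_zero_of_chart h)
    rfl
  have hsurj : Function.Surjective L := by
    refine (LinearMap.injective_iff_surjective_of_finrank_eq_finrank (f := L.toLinearMap) ?_).1 hinj
    simp
  have hmap := hF.map_nhds_eq_of_surj (LinearMap.range_eq_top.2 hsurj)
  have hpos : ∀ᶠ A in 𝓝 (1 : M₂), 0 < (A 0 0).re := by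
    have : Continuous fun A : M₂ => (A 0 0).re := by fun_prop
    exact this.continuousAt.eventually (lt_mem_nhds (by simp))
  have hGc : Tendsto G (𝓝 0) (𝓝 1) := by
    have := hG.continuousAt.tendsto
    rwa [hG0] at this
  have himg := image_mem_map (m := (chart11 ∘ G)) (hGc.eventually hpos)
  change _ ∈ map _ (𝓝 0) at himg
  rw [show map (chart11 ∘ G) (𝓝 0) = 𝓝 (chart11 (G 0)) from hmap, hG0] at himg
  filter_upwards [hpos, chart11.continuous.continuousAt himg] with A hA0 hA hASU
  obtain ⟨t, ht0, ht⟩ := hA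
  have htS : G t ∈ S := hmul _ (hmul _ (h₁ _) _ (h₂ _)) _ (h₃ _)
  rwa [hASU.eq_of_chart_eq (hSU _ htS) hA0 ht0 ht.symm]

end Norm

/-- A closed subgroup of `SU(1,1)` containing a neighbourhood of the identity is everything. -/
lemma mem_of_eventually_mem {S : Set M₂} (hS : IsClosed S) (h1 : (1 : M₂) ∈ S)
    (hmul : ∀ x ∈ S, ∀ y ∈ S, x * y ∈ S) (h : ∀ᶠ A in 𝓝 (1 : M₂), IsSU11 A → A ∈ S)
    {A : M₂} (hA : IsSU11 A) : A ∈ S := by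
  let z : ℝ × ℂ → ℂ := fun p => Complex.exp (p.1 * Complex.I) * (√(1 + ‖p.2‖ ^ 2) : ℝ)
  let P : ℝ × ℂ → M₂ := fun p => !![z p, p.2; conj p.2, conj (z p)]
  have hnorm : ∀ p, ‖z p‖ ^ 2 = 1 + ‖p.2‖ ^ 2 := by
    intro p
    have : 0 ≤ 1 + ‖p.2‖ ^ 2 := by positivity
    simp only [z, norm_mul, Complex.norm_exp_ofReal_mul_I, one_mul, Complex.norm_real,
      Real.norm_eq_abs, sq_abs]
    exact Real.sq_sqrt this
  have hPSU : ∀ p, IsSU11 (P p) := by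
    intro p
    refine ⟨rfl, rfl, ?_⟩
    rw [det_fin_two_of, Complex.mul_conj', Complex.mul_conj', ← Complex.ofReal_pow, hnorm]
    simp
  have hz : Continuous z := by fun_prop
  have hP : Continuous P := by
    refine continuous_matrix fun i j => ?_
    fin_cases i <;> fin_cases j <;> simp [P] <;> fun_prop
  have hopen : IsOpen (P ⁻¹' S) := by
    rw [isOpen_iff_mem_nhds]
    intro p hp
    have hu : IsUnit (P p).det := by rw [(hPSU p).2.2]; exact isUnit_one
    have hc : Continuous fun q => (P p)⁻¹ * P q := by fun_prop
    have ht : Tendsto (fun q => (P p)⁻¹ * P q) (𝓝 p) (𝓝 1) := by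
      have := hc.tendsto p
      rwa [nonsing_inv_mul _ hu] at this
    filter_upwards [ht.eventually h] with q hq
    have h2 : IsSU11 ((P p)⁻¹ * P q) := by
      obtain ⟨a1, a2, a3⟩ := hPSU p
      obtain ⟨b1, b2, b3⟩ := hPSU q
      refine ⟨?_, ?_, ?_⟩
      · simp [inv_def, a3, adjugate_fin_two, mul_apply, Fin.sum_univ_two, a1, a2, b1, b2]; ring
      · simp [inv_def, a3, adjugate_fin_two, mul_apply, Fin.sum_univ_two, a1, a2, b1, b2]; ring
      · rw [det_mul, det_nonsing_inv, a3, b3]; simp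
    have h3 := hmul _ hp _ (hq h2)
    rwa [mul_nonsing_inv_cancel_left _ _ hu] at h3
  have hclopen : IsClopen (P ⁻¹' S) := ⟨hS.preimage hP, hopen⟩
  have huniv := hclopen.eq_univ ⟨(0, 0), by
    have : P (0, 0) = 1 := by
      ext i j
      fin_cases i <;> fin_cases j <;> simp [P, z]
    rwa [Set.mem_preimage, this]⟩
  obtain ⟨a1, a2, a3⟩ := hA
  have hAP : A = P ((A 0 0).arg, A 0 1) := by
    have hz0 : z ((A 0 0).arg, A 0 1) = A 0 0 := by
      rw [det_fin_two, a1, a2, Complex.mul_conj', Complex.mul_conj'] at a3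
      norm_cast at a3
      have : √(1 + ‖A 0 1‖ ^ 2) = ‖A 0 0‖ := by
        rw [← Real.sqrt_sq (norm_nonneg (A 0 0))]
        congr 1
        linarith
      simp only [z, this]
      rw [mul_comm]
      exact Complex.norm_mul_exp_arg_mul_I _
    ext i j
    fin_cases i <;> fin_cases j <;> simp [P, hz0, a1, a2]
  rw [hAP]
  exact Set.eq_univ_iff_forall.1 huniv _

/-- A connected set in which a point is isolated is that point. -/
lemma eq_of_isPreconnected_of_eventually {X : Type*} [TopologicalSpace X] [T1Space X] {S : Set X}
    (hS : IsPreconnected S) {x : X} (hx : x ∈ S) (h : ∀ᶠ y in 𝓝 x, y ∈ S → y = x)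
    {y : X} (hy : y ∈ S) : y = x := by
  obtain ⟨U, hU, hUo, hxU⟩ := eventually_nhds_iff.1 h
  by_contra hne
  obtain ⟨z, hzS, hzU, hzx⟩ := hS U {x}ᶜ hUo isOpen_compl_singleton
    (fun z _ => (em (z = x)).imp (by rintro rfl; exact hxU) id) ⟨x, hx, hxU⟩ ⟨y, hy, hne⟩
  exact hzx (hU z hzU hzS)

/-- In `sl₂`, a matrix orthogonal to `X` and `Y` for the trace form commutes with `[X, Y]`. -/
lemma commute_commutator_of_trace_eq_zero {X Y Z : M₂} (hX : X 1 1 = -X 0 0) (hY : Y 1 1 = -Y 0 0)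
    (hZ : Z 1 1 = -Z 0 0) (hXZ : (X * Z).trace = 0) (hYZ : (Y * Z).trace = 0) :
    (X * Y - Y * X) * Z = Z * (X * Y - Y * X) := by
  simp only [trace_fin_two, mul_apply, Fin.sum_univ_two, hX, hY, hZ] at hXZ hYZ
  ext i j
  fin_cases i <;> fin_cases j <;>
    simp [mul_apply, Fin.sum_univ_two, hX, hY, hZ]
  · linear_combination 2 * X 0 0 * hYZ - 2 * Y 0 0 * hXZ
  · linear_combination 2 * X 0 1 * hYZ - 2 * Y 0 1 * hXZ
  · linear_combination 2 * X 1 0 * hYZ - 2 * Y 1 0 * hXZ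
  · linear_combination -2 * X 0 0 * hYZ + 2 * Y 0 0 * hXZ

lemma IsLieSU11.commutator {X Y : M₂} (hX : IsLieSU11 X) (hY : IsLieSU11 Y) :
    IsLieSU11 (X * Y - Y * X) := by
  obtain ⟨a1, a2, a3⟩ := hX
  obtain ⟨b1, b2, b3⟩ := hY
  refine ⟨?_, ?_, ?_⟩
  · simp [mul_apply, Fin.sum_univ_two, a1, b1, a2, b2]; ring
  · simp [mul_apply, Fin.sum_univ_two, a1, b1, a2, b2]; ring
  · simp [mul_apply, Fin.sum_univ_two, a2, b2, a3, b3]; ring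

lemma linearIndependent_of_trace_commutator {X Y Z : M₂}
    (h : ((X * Y - Y * X) * Z).trace ≠ 0) (r s t : ℝ) (hrst : r • X + s • Y + t • Z = 0) :
    r = 0 ∧ s = 0 ∧ t = 0 := by
  have e1 : ((X * Y - Y * X) * X).trace = 0 := by
    rw [sub_mul, trace_sub, mul_assoc X, trace_mul_comm X, sub_self]
  have e2 : ((X * Y - Y * X) * Y).trace = 0 := by
    rw [sub_mul, trace_sub, mul_assoc Y, trace_mul_comm Y, sub_self]
  have ht : t = 0 := by
    have := congrArg (fun W => ((X * Y - Y * X) * W).trace) hrst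
    simpa [mul_add, e1, e2, h] using this
  subst ht
  rw [zero_smul, add_zero] at hrst
  have hc : X * Y - Y * X ≠ 0 := by
    intro h0
    simp [h0] at h
  have h1 : s • (X * Y - Y * X) = X * (r • X + s • Y) - (r • X + s • Y) * X := by
    simp only [mul_add, add_mul, mul_smul_comm, smul_mul_assoc, smul_sub]
    abel
  have h2 : r • (X * Y - Y * X) = (r • X + s • Y) * Y - Y * (r • X + s • Y) := by
    simp only [mul_add, add_mul, mul_smul_comm, smul_mul_assoc, smul_sub]
    abel
  rw [hrst, mul_zero, zero_mul, sub_zero] at h1 h2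
  exact ⟨(smul_eq_zero.1 h2).resolve_right hc, (smul_eq_zero.1 h1).resolve_right hc, rfl⟩

/-- A closed subgroup of `SU(1,1)` is discrete, or its normaliser stabilises a line in the Lie
algebra, or it contains a neighbourhood of the identity. -/
lemma discrete_or_normalized_line_or_eventually_mem {S : Set M₂} (hS : IsClosed S)
    (hone : 1 ∈ S) (hmul : ∀ x ∈ S, ∀ y ∈ S, x * y ∈ S) (hinv : ∀ x ∈ S, x⁻¹ ∈ S)
    (hSU : ∀ x ∈ S, IsSU11 x) :
    (∀ᶠ A in 𝓝 (1 : M₂), A ∈ S → A = 1) ∨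
    (∃ Y : M₂, IsLieSU11 Y ∧ Y ≠ 0 ∧ ∀ δ : M₂ˣ,
      (∀ A ∈ S, (δ : M₂) * A * (↑δ⁻¹ : M₂) ∈ S ∧ (↑δ⁻¹ : M₂) * A * (δ : M₂) ∈ S) →
      ∃ a : ℂ, (δ : M₂) * Y = a • (Y * (δ : M₂))) ∨
    (∀ᶠ A in 𝓝 (1 : M₂), IsSU11 A → A ∈ S) := by
  by_cases hfreq : ∃ᶠ A in 𝓝 (1 : M₂), A ∈ S ∧ A ≠ 1
  swap
  · left
    filter_upwards [not_frequently.1 hfreq] with A hA hAS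
    by_contra h
    exact hA ⟨hAS, h⟩
  right
  have hpow : ∀ x ∈ S, ∀ n : ℕ, x ^ n ∈ S := by
    intro x hx n
    induction n with
    | zero => simpa using hone
    | succ n ih => rw [pow_succ]; exact hmul _ ih _ hx
  obtain ⟨X₀, hX₀, hX₀L, hX₀S⟩ := exists_lie_of_frequently hS hpow hinv hSU hfreq
  let L : Set M₂ := {X | ∀ t : ℝ, NormedSpace.exp (t • X) ∈ S}
  have hL : ∀ X ∈ L, IsLieSU11 X := fun X hX => isLieSU11_of_exp fun t => hSU _ (hX t)
  have hconj : ∀ δ : M₂ˣ, (∀ A ∈ S, (δ : M₂) * A * (↑δ⁻¹ : M₂) ∈ S) →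
      ∀ X ∈ L, (δ : M₂) * X * (↑δ⁻¹ : M₂) ∈ L := by
    intro δ hδ X hX t
    have : t • ((δ : M₂) * X * (↑δ⁻¹ : M₂)) = (δ : M₂) * (t • X) * (↑δ⁻¹ : M₂) := by simp
    rw [this, Matrix.exp_units_conj]
    exact hδ _ (hX t)
  have hline : ∀ (δ : M₂ˣ) (Y : M₂) (a : ℂ), (δ : M₂) * Y * (↑δ⁻¹ : M₂) = a • Y →
      (δ : M₂) * Y = a • (Y * (δ : M₂)) := by
    intro δ Y a h
    rw [← smul_mul_assoc, ← h, Units.inv_mul_cancel_right]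
  have htr : ∀ (δ : M₂ˣ) (Y : M₂), Y 1 1 = -Y 0 0 → ((δ : M₂) * Y * (↑δ⁻¹ : M₂)) 1 1 =
      -((δ : M₂) * Y * (↑δ⁻¹ : M₂)) 0 0 := by
    intro δ Y hY
    have : ((δ : M₂) * Y * (↑δ⁻¹ : M₂)).trace = Y.trace := trace_units_conj δ Y
    rw [trace_fin_two, trace_fin_two, hY] at this
    linear_combination this
  by_cases hcomm : ∀ X ∈ L, ∀ Z ∈ L, X * Z = Z * X
  · refine Or.inl ⟨X₀, hX₀L, hX₀, fun δ hδ => ?_⟩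
    have h1 := hconj δ (fun A hA => (hδ A hA).1) X₀ hX₀S
    obtain ⟨a, ha⟩ := exists_smul_of_commute hX₀L.2.2 (hL _ h1).2.2 hX₀ (hcomm _ hX₀S _ h1)
    exact ⟨a, hline δ X₀ a ha⟩
  · push Not at hcomm
    obtain ⟨X₁, h₁, X₂, h₂, h12⟩ := hcomm
    set Y := X₁ * X₂ - X₂ * X₁ with hY
    have hY0 : Y ≠ 0 := sub_ne_zero.2 h12
    have hYL : IsLieSU11 Y := (hL _ h₁).commutator (hL _ h₂)
    by_cases horth : ∀ Z ∈ L, (Y * Z).trace = 0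
    · refine Or.inl ⟨Y, hYL, hY0, fun δ hδ => ?_⟩
      have h0 : ∀ X ∈ L, (X * ((δ : M₂) * Y * (↑δ⁻¹ : M₂))).trace = 0 := by
        intro X hX
        have h1 := hconj δ⁻¹ (fun A hA => by simpa using (hδ A hA).2) X hX
        rw [inv_inv] at h1
        rw [← horth _ h1, trace_mul_comm, mul_assoc, mul_assoc, trace_mul_comm]
        simp only [mul_assoc]
      obtain ⟨a, ha⟩ := exists_smul_of_commute hYL.2.2 (htr δ Y hYL.2.2) hY0
        (commute_commutator_of_trace_eq_zero (hL _ h₁).2.2 (hL _ h₂).2.2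
          (htr δ Y hYL.2.2) (h0 _ h₁) (h0 _ h₂))
      exact ⟨a, hline δ Y a ha⟩
    · push Not at horth
      obtain ⟨X₃, h₃, h123⟩ := horth
      exact Or.inr (eventually_mem_of_basis hmul hSU h₁ h₂ h₃
        (linearIndependent_of_trace_commutator h123))

/-- Lemma 4.1: with `α, β, γ ∈ U(1,1)` as in the lemma, every closed connected subgroup of
`SU(1,1)` normalized by `α`, `β` and `γ` is trivial or all of `SU(1,1)`. -/
theorem stmt_8 (J : Matrix (Fin 2) (Fin 2) ℂ) (hJ : J = Matrix.diagonal ![1, -1])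
    (α β γ : (Matrix (Fin 2) (Fin 2) ℂ)ˣ)
    (hαJ : (↑α : Matrix (Fin 2) (Fin 2) ℂ)ᴴ * J * (↑α : Matrix (Fin 2) (Fin 2) ℂ) = J)
    (hβJ : (↑β : Matrix (Fin 2) (Fin 2) ℂ)ᴴ * J * (↑β : Matrix (Fin 2) (Fin 2) ℂ) = J)
    (hγJ : (↑γ : Matrix (Fin 2) (Fin 2) ℂ)ᴴ * J * (↑γ : Matrix (Fin 2) (Fin 2) ℂ) = J)
    -- (i): finite order or unipotent, and not scalar
    (hα₁ : (∃ p : ℕ, 1 ≤ p ∧ α ^ p = 1) ∨ ((↑α - 1 : Matrix (Fin 2) (Fin 2) ℂ)) ^ 2 = 0)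
    (hβ₁ : (∃ p : ℕ, 1 ≤ p ∧ β ^ p = 1) ∨ ((↑β - 1 : Matrix (Fin 2) (Fin 2) ℂ)) ^ 2 = 0)
    (hγ₁ : (∃ p : ℕ, 1 ≤ p ∧ γ ^ p = 1) ∨ ((↑γ - 1 : Matrix (Fin 2) (Fin 2) ℂ)) ^ 2 = 0)
    (hα₂ : ∀ μ : ℂ, (↑α : Matrix (Fin 2) (Fin 2) ℂ) ≠ μ • 1)
    (hβ₂ : ∀ μ : ℂ, (↑β : Matrix (Fin 2) (Fin 2) ℂ) ≠ μ • 1)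
    (hγ₂ : ∀ μ : ℂ, (↑γ : Matrix (Fin 2) (Fin 2) ℂ) ≠ μ • 1)
    -- (ii): three distinct fixed lines
    (uα uβ uγ : Fin 2 → ℂ) (huα : uα ≠ 0) (huβ : uβ ≠ 0) (huγ : uγ ≠ 0)
    (hαβ : Submodule.span ℂ {uα} ≠ Submodule.span ℂ {uβ})
    (hβγ : Submodule.span ℂ {uβ} ≠ Submodule.span ℂ {uγ})
    (hαγ : Submodule.span ℂ {uα} ≠ Submodule.span ℂ {uγ})
    (hfixα : ∃ μ : ℂ, (↑α : Matrix (Fin 2) (Fin 2) ℂ) *ᵥ uα = μ • uα)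
    (hfixβ : ∃ μ : ℂ, (↑β : Matrix (Fin 2) (Fin 2) ℂ) *ᵥ uβ = μ • uβ)
    (hfixγ : ∃ μ : ℂ, (↑γ : Matrix (Fin 2) (Fin 2) ℂ) *ᵥ uγ = μ • uγ)
    -- (iii): the product is scalar
    (hprod : ∃ lam : ℂ, (↑(α * β * γ) : Matrix (Fin 2) (Fin 2) ℂ) = lam • 1)
    -- `H` a subgroup of `SU(J)` …
    (H : Subgroup (Matrix (Fin 2) (Fin 2) ℂ)ˣ)
    (hHSU : ∀ A ∈ H, (↑A : Matrix (Fin 2) (Fin 2) ℂ)ᴴ * J * (↑A : Matrix (Fin 2) (Fin 2) ℂ) = J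
      ∧ (↑A : Matrix (Fin 2) (Fin 2) ℂ).det = 1)
    -- … whose underlying set is closed and connected in `M₂(ℂ)` …
    (hclosed : IsClosed ((fun A : (Matrix (Fin 2) (Fin 2) ℂ)ˣ =>
      (↑A : Matrix (Fin 2) (Fin 2) ℂ)) '' (H : Set (Matrix (Fin 2) (Fin 2) ℂ)ˣ)))
    (hconn : IsConnected ((fun A : (Matrix (Fin 2) (Fin 2) ℂ)ˣ =>
      (↑A : Matrix (Fin 2) (Fin 2) ℂ)) '' (H : Set (Matrix (Fin 2) (Fin 2) ℂ)ˣ)))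
    -- … and normalized by `α`, `β` and `γ`
    (hnormα : ∀ X : (Matrix (Fin 2) (Fin 2) ℂ)ˣ, X ∈ H ↔ α * X * α⁻¹ ∈ H)
    (hnormβ : ∀ X : (Matrix (Fin 2) (Fin 2) ℂ)ˣ, X ∈ H ↔ β * X * β⁻¹ ∈ H)
    (hnormγ : ∀ X : (Matrix (Fin 2) (Fin 2) ℂ)ˣ, X ∈ H ↔ γ * X * γ⁻¹ ∈ H) :
    (∀ A : (Matrix (Fin 2) (Fin 2) ℂ)ˣ, A ∈ H ↔ A = 1) ∨
    (∀ A : (Matrix (Fin 2) (Fin 2) ℂ)ˣ, A ∈ H ↔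
      ((↑A : Matrix (Fin 2) (Fin 2) ℂ)ᴴ * J * (↑A : Matrix (Fin 2) (Fin 2) ℂ) = J
        ∧ (↑A : Matrix (Fin 2) (Fin 2) ℂ).det = 1)) := by
  subst hJ
  set S : Set M₂ := (fun A : M₂ˣ => (↑A : M₂)) '' (H : Set M₂ˣ) with hS
  have hmem : ∀ A : M₂ˣ, (A : M₂) ∈ S ↔ A ∈ H := fun A =>
    ⟨fun ⟨B, hB, h⟩ => Units.ext h ▸ hB, fun h => ⟨A, h, rfl⟩⟩
  have hone : (1 : M₂) ∈ S := (hmem 1).2 H.one_mem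
  have hmul : ∀ x ∈ S, ∀ y ∈ S, x * y ∈ S := by
    rintro _ ⟨A, hA, rfl⟩ _ ⟨B, hB, rfl⟩
    exact ⟨A * B, H.mul_mem hA hB, rfl⟩
  have hinv : ∀ x ∈ S, x⁻¹ ∈ S := by
    rintro _ ⟨A, hA, rfl⟩
    exact ⟨A⁻¹, H.inv_mem hA, coe_units_inv A⟩
  have hSU : ∀ x ∈ S, IsSU11 x := by
    rintro _ ⟨A, hA, rfl⟩
    exact (isSU11_iff _).2 (hHSU A hA)
  have hnorm : ∀ δ : M₂ˣ, (∀ X : M₂ˣ, X ∈ H ↔ δ * X * δ⁻¹ ∈ H) →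
      ∀ A ∈ S, (δ : M₂) * A * (↑δ⁻¹ : M₂) ∈ S ∧ (↑δ⁻¹ : M₂) * A * (δ : M₂) ∈ S := by
    rintro δ hδ _ ⟨A, hA, rfl⟩
    refine ⟨⟨δ * A * δ⁻¹, (hδ A).1 hA, rfl⟩, δ⁻¹ * A * δ, (hδ _).2 ?_, rfl⟩
    simpa [mul_assoc] using hA
  have hord : ∀ δ : M₂ˣ, ((∃ p : ℕ, 1 ≤ p ∧ δ ^ p = 1) ∨ (↑δ - 1 : M₂) ^ 2 = 0) →
      (∃ p : ℕ, 1 ≤ p ∧ (δ : M₂) ^ p = 1) ∨ (↑δ - 1 : M₂) ^ 2 = 0 :=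
    fun δ h => h.imp_left fun ⟨p, hp, h⟩ => ⟨p, hp, by simpa using congrArg Units.val h⟩
  rcases discrete_or_normalized_line_or_eventually_mem hclosed hone hmul hinv hSU with
    h | ⟨Y, hY, hY0, hline⟩ | h
  · refine Or.inl fun A => ⟨fun hA => Units.ext ?_, fun hA => hA ▸ H.one_mem⟩
    exact eq_of_isPreconnected_of_eventually hconn.isPreconnected hone h ((hmem A).2 hA)
  · obtain ⟨l, hl⟩ := hprod
    obtain ⟨a, ha⟩ := hline α (hnorm α hnormα)
    obtain ⟨b, hb⟩ := hline β (hnorm β hnormβ)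
    obtain ⟨c, hc⟩ := hline γ (hnorm γ hnormγ)
    exact (no_normalized_line hY hY0 hαJ hβJ hγJ (hord α hα₁) (hord β hβ₁) (hord γ hγ₁) hα₂ hβ₂
      hγ₂ huα huβ huγ hαβ hβγ hαγ hfixα hfixβ hfixγ hl ha hb hc).elim
  · refine Or.inr fun A => ⟨hHSU A, fun hA => (hmem A).1 ?_⟩
    exact mem_of_eventually_mem hclosed hone hmul h ((isSU11_iff _).2 hA)
end

section
/- Let h be a nondegenerate Hermitian sesquilinear form on ℂ² (linear in the first variable, conjugate-linear in the second, h(y,x) = conj(h(x,y))). Let v ∈ ℂ² be nonzero with h(v,v) = 0, and let T : ℂ² → ℂ² be a ℂ-linear map preserving h (h(Tx,Ty) = h(x,y) for all x, y) such that T(v) ∈ ℂ·v and T^p = id for some integer p ≥ 1. Then T is a complex scalar multiple of the identity. -/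
theorem Module.End.pow_apply_of_eigenvector {K V : Type*} [CommRing K] [AddCommGroup V] [Module K V]
    {T : Module.End K V} {v : V} {μ : K} (hv : T v = μ • v) (n : ℕ) :
    (T ^ n) v = μ ^ n • v := by
  induction n with
  | zero => simp
  | succ n ih => rw [pow_succ', Module.End.mul_apply, ih, map_smul, hv, smul_smul, pow_succ]

theorem Module.End.pow_succ_apply_of_jordan_chain {K V : Type*} [CommRing K] [AddCommGroup V]
    [Module K V] {T : Module.End K V} {v w : V} {μ c : K} (hv : T v = μ • v)
    (hw : T w = μ • w + c • v) (n : ℕ) :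
    (T ^ (n + 1)) w = μ ^ (n + 1) • w + ((n + 1) * μ ^ n * c) • v := by
  induction n with
  | zero => simp [hw]
  | succ n ih =>
    rw [pow_succ', Module.End.mul_apply, ih, map_add, map_smul, map_smul, hv, hw]
    push_cast
    module

theorem Module.End.eigenvalue_pow_eq_one {K V : Type*} [Field K] [AddCommGroup V] [Module K V]
    {T : Module.End K V} {v : V} {μ : K} (hv0 : v ≠ 0) (hv : T v = μ • v) {p : ℕ}
    (hT : T ^ p = 1) : μ ^ p = 1 := by
  have h1 := pow_apply_of_eigenvector hv p
  rw [hT, Module.End.one_apply] at h1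
  exact smul_left_injective K hv0 (by simpa using h1.symm)

theorem Module.End.apply_eq_smul_of_pow_eq_one {K V : Type*} [Field K] [CharZero K]
    [AddCommGroup V] [Module K V] {T : Module.End K V} {v w : V} {μ c : K} (hv0 : v ≠ 0)
    (hv : T v = μ • v) (hw : T w = μ • w + c • v) {p : ℕ} (hp : 1 ≤ p) (hT : T ^ p = 1) :
    T w = μ • w := by
  obtain ⟨n, rfl⟩ := Nat.exists_eq_add_of_le' hp
  have hμ : μ ^ (n + 1) = 1 := eigenvalue_pow_eq_one hv0 hv hT
  have h2 := pow_succ_apply_of_jordan_chain hv hw n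
  rw [hT, Module.End.one_apply, hμ, one_smul, left_eq_add, smul_eq_zero_iff_left hv0] at h2
  have hμ0 : μ ≠ 0 := by
    rintro rfl
    simp at hμ
  have hn : (n + 1 : K) ≠ 0 := Nat.cast_add_one_ne_zero n
  have hc : c = 0 := by simpa [hn, hμ0] using h2
  simp [hw, hc]

/-- Step in the proof of Lemma 4.1: a finite-order isometry of a nondegenerate Hermitian form on
`ℂ²` fixing an isotropic line is a scalar multiple of the identity. -/
theorem stmt_9 (h : (Fin 2 → ℂ) → (Fin 2 → ℂ) → ℂ)
    (hadd : ∀ x y z : Fin 2 → ℂ, h (x + y) z = h x z + h y z)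
    (hsmul : ∀ (a : ℂ) (x y : Fin 2 → ℂ), h (a • x) y = a * h x y)
    (hherm : ∀ x y : Fin 2 → ℂ, h y x = (starRingEnd ℂ) (h x y))
    (hndg : ∀ x : Fin 2 → ℂ, (∀ y : Fin 2 → ℂ, h x y = 0) → x = 0)
    (v : Fin 2 → ℂ) (hv : v ≠ 0) (hvv : h v v = 0)
    (T : (Fin 2 → ℂ) →ₗ[ℂ] (Fin 2 → ℂ))
    (hTh : ∀ x y : Fin 2 → ℂ, h (T x) (T y) = h x y)
    (hTv : ∃ μ : ℂ, T v = μ • v)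
    (p : ℕ) (hp : 1 ≤ p) (hTp : T ^ p = 1) :
    ∃ μ : ℂ, ∀ x : Fin 2 → ℂ, T x = μ • x := by
  obtain ⟨μ, hμ⟩ := hTv
  have hzero (y : Fin 2 → ℂ) : h 0 y = 0 := by simpa using hsmul 0 0 y
  have hsmul_right (a : ℂ) (x y : Fin 2 → ℂ) : h x (a • y) = starRingEnd ℂ a * h x y := by
    rw [hherm, hsmul, map_mul, ← hherm]
  obtain ⟨w, hw⟩ : ∃ w, h w v ≠ 0 := by
    by_contra! hcon
    exact hv (hndg v fun y => by rw [hherm, hcon, map_zero])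
  have hli : LinearIndependent ℂ ![v, w] := by
    refine LinearIndependent.pair_iff.2 fun a b hab => ?_
    have hb : b = 0 := by
      have := hadd (a • v) (b • w) v
      rw [hab, hzero, hsmul, hsmul, hvv] at this
      simpa [hw] using this
    simpa [hb, hv] using hab
  have hspan : Submodule.span ℂ (Set.range ![v, w]) = ⊤ :=
    hli.span_eq_top_of_card_eq_finrank' (by simp)
  have hperp (z : Fin 2 → ℂ) (hz : h z v = 0) : ∃ c : ℂ, z = c • v := by
    have hmem : z ∈ Submodule.span ℂ (Set.range ![v, w]) := hspan ▸ Submodule.mem_top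
    rw [Matrix.range_cons_cons_empty, Submodule.mem_span_pair] at hmem
    obtain ⟨a, b, rfl⟩ := hmem
    have hb : b = 0 := by simpa [hadd, hsmul, hvv, hw] using hz
    exact ⟨a, by simp [hb]⟩
  have hnorm : μ * starRingEnd ℂ μ = 1 := by
    have hμp : μ ^ p = 1 := Module.End.eigenvalue_pow_eq_one hv hμ hTp
    rw [Complex.mul_conj', Complex.norm_eq_one_of_pow_eq_one hμp (by lia)]
    simp
  refine ⟨μ, fun x => ?_⟩
  obtain ⟨c, hc⟩ := hperp (T x + (-μ) • x) <| by
    have h1 := hTh x v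
    rw [hμ, hsmul_right] at h1
    rw [hadd, hsmul, ← h1]
    linear_combination (-h (T x) v) * hnorm
  refine Module.End.apply_eq_smul_of_pow_eq_one (c := c) hv hμ ?_ hp hTp
  rw [← hc]
  module
end

section
/- Let U(2) = {A ∈ M₂(ℂ) : Aᴴ·A = I}. Let α, β, γ ∈ U(2) be such that: (i) each of α, β, γ has finite order and none is a complex scalar multiple of the identity matrix; (ii) there exist nonzero vectors u_α, u_β, u_γ ∈ ℂ² spanning three pairwise distinct complex lines, with α(u_α) ∈ ℂ·u_α, β(u_β) ∈ ℂ·u_β, γ(u_γ) ∈ ℂ·u_γ; (iii) α·β·γ = λ·I for some λ ∈ ℂ; (iv) α^j is not a scalar multiple of the identity for j = 1, …, 5, and β^j is not a scalar multiple of the identity for j = 1, 2. Then there is no finite set F ⊆ U(2) such that the subgroup generated by α, β, γ is contained in ⋃_{A ∈ F} {μ·A : μ ∈ ℂ}; equivalently, the image of ⟨α, β, γ⟩ in the quotient of U(2) by its subgroup of scalar matrices is infinite. -/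
theorem unitary_col_normSq (g : Matrix.unitaryGroup (Fin 2) ℂ) :
    Complex.normSq (g.1 0 0) + Complex.normSq (g.1 1 0) = 1 := by
  have h := congrFun (congrFun (Matrix.mem_unitaryGroup_iff'.1 g.2) 0) 0
  simp only [Matrix.mul_apply, Fin.sum_univ_two, Matrix.star_apply, Matrix.one_apply_eq,
    RCLike.star_def, ← Complex.normSq_eq_conj_mul_self] at h
  exact_mod_cast h

theorem unitary_row_normSq (g : Matrix.unitaryGroup (Fin 2) ℂ) (i : Fin 2) :
    Complex.normSq (g.1 i 0) + Complex.normSq (g.1 i 1) = 1 := by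
  have h := congrFun (congrFun (Matrix.mem_unitaryGroup_iff.1 g.2) i) i
  simp only [Matrix.mul_apply, Fin.sum_univ_two, Matrix.star_apply, Matrix.one_apply_eq,
    RCLike.star_def, Complex.mul_conj] at h
  exact_mod_cast h

theorem unitary_upper_zero_of_lower_zero (g : Matrix.unitaryGroup (Fin 2) ℂ) (h : g.1 1 0 = 0) :
    g.1 0 1 = 0 := by
  have h1 := unitary_col_normSq g
  have h2 := unitary_row_normSq g 0
  rw [h, map_zero] at h1
  exact Complex.normSq_eq_zero.1 (by linarith)

theorem unitary_antidiagonal_of_zero (g : Matrix.unitaryGroup (Fin 2) ℂ) (h : g.1 0 0 = 0) :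
    g.1 1 1 = 0 := by
  have h1 := unitary_col_normSq g
  have h2 := unitary_row_normSq g 1
  rw [h, map_zero] at h1
  exact Complex.normSq_eq_zero.1 (by linarith)

theorem normSq_convex_comb (s t : ℂ) (hs : Complex.normSq s = 1) (ht : Complex.normSq t = 1)
    (x y : ℝ) : Complex.normSq (s * x + t * y)
      = x ^ 2 + y ^ 2 + 2 * x * y * (s * (starRingEnd ℂ) t).re := by
  rw [Complex.normSq_add, map_mul, map_mul, hs, ht, Complex.normSq_ofReal, Complex.normSq_ofReal]
  simp only [map_mul, Complex.conj_ofReal, Complex.mul_re, Complex.mul_im, Complex.ofReal_re,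
    Complex.ofReal_im, Complex.conj_re, Complex.conj_im]
  ring

theorem exists_pow_re_ge_half (s t : ℂ) (ht : Complex.normSq t = 1)
    (p : ℕ) (hp : 1 ≤ p) (hpow : s ^ p = t ^ p)
    (hne : ∀ j : ℕ, 1 ≤ j → j ≤ 5 → s ^ j ≠ t ^ j) :
    ∃ k : ℕ, 1 / 2 ≤ (s ^ k * (starRingEnd ℂ) (t ^ k)).re ∧
      (s ^ k * (starRingEnd ℂ) (t ^ k)).re < 1 := by
  have htc : t * (starRingEnd ℂ) t = 1 := by rw [Complex.mul_conj, ht, Complex.ofReal_one]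
  have hr (j : ℕ) : (s * (starRingEnd ℂ) t) ^ j = 1 ↔ s ^ j = t ^ j := by
    have h1 : t ^ j * (starRingEnd ℂ) t ^ j = 1 := by rw [← mul_pow, htc, one_pow]
    have h0 : (starRingEnd ℂ) t ^ j ≠ 0 := right_ne_zero_of_mul_eq_one h1
    rw [mul_pow]
    constructor
    · intro h
      exact mul_right_cancel₀ h0 (h.trans h1.symm)
    · intro h
      rw [h, h1]
  set r := s * (starRingEnd ℂ) t with hrdef
  have hfin : IsOfFinOrder r := isOfFinOrder_iff_pow_eq_one.2 ⟨p, hp, (hr p).2 hpow⟩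
  have hpos : 0 < orderOf r := hfin.orderOf_pos
  have h6 : 6 ≤ orderOf r := by
    by_contra! hlt
    exact hne (orderOf r) hpos (by omega) ((hr _).1 (pow_orderOf_eq_one r))
  have : NeZero (orderOf r) := ⟨hpos.ne'⟩
  have hprim := Complex.isPrimitiveRoot_exp (orderOf r) hpos.ne'
  obtain ⟨k, -, hk⟩ := (IsPrimitiveRoot.orderOf r).eq_pow_of_pow_eq_one hprim.pow_eq_one
  have h6' : (6 : ℝ) ≤ orderOf r := by exact_mod_cast h6
  have hre : (s ^ k * (starRingEnd ℂ) (t ^ k)).re = Real.cos (2 * Real.pi / orderOf r) := by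
    rw [map_pow, ← mul_pow, ← hrdef, hk,
      show 2 * (Real.pi : ℂ) * Complex.I / (orderOf r : ℂ)
        = ((2 * Real.pi / orderOf r : ℝ) : ℂ) * Complex.I by push_cast; ring,
      Complex.exp_ofReal_mul_I_re]
  have hang : 2 * Real.pi / orderOf r ≤ Real.pi / 3 := by
    rw [div_le_div_iff₀ (by linarith) (by norm_num)]
    nlinarith [Real.pi_pos]
  have hang0 : 0 < 2 * Real.pi / orderOf r := by
    have := Real.pi_pos
    positivity
  refine ⟨k, ?_, ?_⟩
  · rw [hre, ← Real.cos_pi_div_three]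
    exact Real.cos_le_cos_of_nonneg_of_le_pi hang0.le (by linarith [Real.pi_pos]) hang
  · rw [hre, ← Real.cos_zero]
    exact Real.cos_lt_cos_of_nonneg_of_le_pi le_rfl (by linarith [Real.pi_pos]) hang0

theorem inv_mul_mul_apply_zero_zero (a g : Matrix.unitaryGroup (Fin 2) ℂ)
    (h10 : a.1 1 0 = 0) :
    (g⁻¹ * a * g).1 0 0 =
      a.1 0 0 * (Complex.normSq (g.1 0 0) : ℝ) + a.1 1 1 * (Complex.normSq (g.1 1 0) : ℝ) := by
  have h01 := unitary_upper_zero_of_lower_zero a h10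
  have : (g⁻¹ * a * g).1 = star g.1 * a.1 * g.1 := rfl
  rw [this]
  simp only [Matrix.mul_apply, Fin.sum_univ_two, Matrix.star_apply, h10, h01,
    RCLike.star_def, Complex.normSq_eq_conj_mul_self]
  ring

/-- If a subgroup of `U(2)` takes finitely many values of `|g₀₀|²` and contains a diagonal element
rotating by a nonzero angle at most `π / 3`, it preserves the pair of coordinate lines. -/
theorem subgroup_monomial_of_small_rotation (G : Subgroup (Matrix.unitaryGroup (Fin 2) ℂ))
    (hfin : {x : ℝ | ∃ g ∈ G, Complex.normSq (g.1 0 0) = x}.Finite)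
    (a : Matrix.unitaryGroup (Fin 2) ℂ) (ha : a ∈ G) (h10 : a.1 1 0 = 0)
    (hre : 1 / 2 ≤ (a.1 0 0 * (starRingEnd ℂ) (a.1 1 1)).re)
    (hre' : (a.1 0 0 * (starRingEnd ℂ) (a.1 1 1)).re < 1)
    (g : Matrix.unitaryGroup (Fin 2) ℂ) (hg : g ∈ G) : g.1 0 0 = 0 ∨ g.1 1 0 = 0 := by
  by_contra! hcon
  have hcol := unitary_col_normSq g
  have hx0 := Complex.normSq_pos.2 hcon.1
  have hy0 := Complex.normSq_pos.2 hcon.2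
  have hfin' := hfin.inter_of_left (Set.Ioo (0 : ℝ) 1)
  obtain ⟨x, ⟨⟨h, hh, rfl⟩, hx1, hx2⟩, hmax⟩ := Set.exists_max_image _ id hfin'
    ⟨_, ⟨g, hg, rfl⟩, hx0, by linarith⟩
  have hs : Complex.normSq (a.1 0 0) = 1 := by
    simpa [h10] using unitary_col_normSq a
  have ht : Complex.normSq (a.1 1 1) = 1 := by
    simpa [h10] using unitary_row_normSq a 1
  have hval := normSq_convex_comb _ _ hs ht (Complex.normSq (h.1 0 0)) (Complex.normSq (h.1 1 0))
  rw [← inv_mul_mul_apply_zero_zero a h h10] at hval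
  have hcol' : Complex.normSq (h.1 1 0) = 1 - Complex.normSq (h.1 0 0) := by
    linarith [unitary_col_normSq h]
  rw [hcol'] at hval
  set ρ := (a.1 0 0 * (starRingEnd ℂ) (a.1 1 1)).re
  set X := Complex.normSq (h.1 0 0)
  have hXY : 0 < X * (1 - X) := mul_pos hx1 (by linarith)
  have hlow : X < Complex.normSq ((h⁻¹ * a * h).1 0 0) := by
    rw [hval]
    nlinarith [mul_nonneg hXY.le (sub_nonneg.2 hre), pow_pos (sub_pos.2 hx2) 2]
  have hhigh : Complex.normSq ((h⁻¹ * a * h).1 0 0) < 1 := by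
    rw [hval]
    nlinarith [mul_pos hXY (sub_pos.2 hre')]
  have := hmax _ ⟨⟨h⁻¹ * a * h, G.mul_mem (G.mul_mem (G.inv_mem hh) ha) hh, rfl⟩,
    hx1.trans hlow, hhigh⟩
  exact absurd hlow (not_lt.2 this)

theorem exists_unitary_smul_col (u : Fin 2 → ℂ) (hu : u ≠ 0) :
    ∃ P : Matrix.unitaryGroup (Fin 2) ℂ, ∃ c : ℂ, ∀ i, u i = c * P.1 i 0 := by
  have hpos : 0 < Complex.normSq (u 0) + Complex.normSq (u 1) := by
    by_contra! hle
    have h0 := Complex.normSq_nonneg (u 0)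
    have h1 := Complex.normSq_nonneg (u 1)
    refine hu (funext fun i => ?_)
    have e0 : u 0 = 0 := Complex.normSq_eq_zero.1 (by linarith)
    have e1 : u 1 = 0 := Complex.normSq_eq_zero.1 (by linarith)
    fin_cases i
    · exact e0
    · exact e1
  set r : ℝ := √(Complex.normSq (u 0) + Complex.normSq (u 1)) with hr
  have hr2 : (r : ℂ) * r = Complex.normSq (u 0) + Complex.normSq (u 1) := by
    rw [← Complex.ofReal_mul, hr, Real.mul_self_sqrt hpos.le, Complex.ofReal_add]
  have hr0 : (r : ℂ) ≠ 0 := Complex.ofReal_ne_zero.2 (Real.sqrt_pos.2 hpos).ne'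
  rw [← Complex.mul_conj, ← Complex.mul_conj] at hr2
  refine ⟨⟨!![u 0 / r, -(starRingEnd ℂ) (u 1) / r; u 1 / r, (starRingEnd ℂ) (u 0) / r],
    Matrix.mem_unitaryGroup_iff'.2 ?_⟩, r, ?_⟩
  · ext i j
    fin_cases i <;> fin_cases j <;>
      simp [Matrix.mul_apply, Fin.sum_univ_two, Matrix.star_apply] <;> field_simp <;>
      first | ring1 | linear_combination -hr2
  · intro i
    fin_cases i <;> simp <;> field_simp

theorem eq_diagonal_of_lower_zero (g : Matrix.unitaryGroup (Fin 2) ℂ) (h : g.1 1 0 = 0) :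
    g.1 = Matrix.diagonal ![g.1 0 0, g.1 1 1] := by
  have h' := unitary_upper_zero_of_lower_zero g h
  ext i j
  fin_cases i <;> fin_cases j <;> simp [h, h']

theorem coe_pow_eq_diagonal (g : Matrix.unitaryGroup (Fin 2) ℂ) (h : g.1 1 0 = 0) (j : ℕ) :
    (g ^ j).1 = Matrix.diagonal ![g.1 0 0 ^ j, g.1 1 1 ^ j] := by
  have h1 : (g ^ j).1 = g.1 ^ j := rfl
  rw [h1, eq_diagonal_of_lower_zero g h, Matrix.diagonal_pow]
  congr 1
  ext i
  fin_cases i <;> simp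

theorem diagonal_pair_eq_smul_one (x : ℂ) :
    Matrix.diagonal ![x, x] = x • (1 : Matrix (Fin 2) (Fin 2) ℂ) := by
  ext i j
  fin_cases i <;> fin_cases j <;> simp

theorem eigenvector_coord_zero_of_diagonal (g : Matrix.unitaryGroup (Fin 2) ℂ)
    (h : g.1 1 0 = 0) (hns : ∀ μ : ℂ, g.1 ≠ μ • 1) (v : Fin 2 → ℂ)
    (hv : ∃ μ : ℂ, Matrix.mulVec g.1 v = μ • v) : v 0 = 0 ∨ v 1 = 0 := by
  obtain ⟨μ, hμ⟩ := hv
  have hd := eq_diagonal_of_lower_zero g h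
  rw [hd] at hμ
  have e0 := congrFun hμ 0
  have e1 := congrFun hμ 1
  simp only [Matrix.mulVec_diagonal, Matrix.cons_val_zero, Matrix.cons_val_one,
    Pi.smul_apply, smul_eq_mul] at e0 e1
  by_contra! hcon
  have f0 := mul_right_cancel₀ hcon.1 e0
  have f1 := mul_right_cancel₀ hcon.2 e1
  refine hns μ ?_
  rw [hd, f0, f1, diagonal_pair_eq_smul_one]

theorem exists_smul_eq_of_coord_zero (u v : Fin 2 → ℂ) (hu : u ≠ 0) (i : Fin 2)
    (hui : u i = 0) (hvi : v i = 0) : ∃ c : ℂ, v = c • u := by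
  have key (j : Fin 2) (hij : ∀ k, k = i ∨ k = j) : ∃ c : ℂ, v = c • u := by
    have huj : u j ≠ 0 := by
      intro huj
      refine hu (funext fun k => ?_)
      rcases hij k with rfl | rfl
      · exact hui
      · exact huj
    refine ⟨v j / u j, funext fun k => ?_⟩
    rcases hij k with rfl | rfl
    · simp [hui, hvi]
    · simp [huj]
  fin_cases i
  · exact key 1 (by decide)
  · exact key 0 (by decide)

theorem span_singleton_eq_of_exists_smul {u v : Fin 2 → ℂ} (hv : v ≠ 0)
    (h : ∃ c : ℂ, v = c • u) : Submodule.span ℂ {u} = Submodule.span ℂ {v} := by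
  obtain ⟨c, rfl⟩ := h
  have hc : c ≠ 0 := by
    rintro rfl
    simp at hv
  exact (Submodule.span_singleton_smul_eq (IsUnit.mk0 c hc) u).symm

/-- A subgroup of `U(2)` containing `α` and `β`, where `α`, `β`, `γ` fix three distinct lines, the
first being a coordinate line, takes infinitely many values of `|g₀₀|²` if `α` and `β` have
projective orders greater than 5 and 2. -/
theorem infinite_of_fixed_coordinate_line (α β γ : Matrix.unitaryGroup (Fin 2) ℂ)
    (hα₁ : ∃ p : ℕ, 1 ≤ p ∧ α ^ p = 1)
    (hβ₂ : ∀ μ : ℂ, β.1 ≠ μ • 1) (hγ₂ : ∀ μ : ℂ, γ.1 ≠ μ • 1)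
    (uα uβ uγ : Fin 2 → ℂ) (huα : uα ≠ 0) (huβ : uβ ≠ 0)
    (hαβ : ¬ ∃ c : ℂ, uβ = c • uα) (hβγ : ¬ ∃ c : ℂ, uγ = c • uβ)
    (hαγ : ¬ ∃ c : ℂ, uγ = c • uα)
    (hfixα : ∃ μ : ℂ, Matrix.mulVec α.1 uα = μ • uα)
    (hfixβ : ∃ μ : ℂ, Matrix.mulVec β.1 uβ = μ • uβ)
    (hfixγ : ∃ μ : ℂ, Matrix.mulVec γ.1 uγ = μ • uγ)
    (hprod : ∃ lam : ℂ, (α * β * γ).1 = lam • 1)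
    (hα₃ : ∀ j : ℕ, 1 ≤ j → j ≤ 5 → ∀ μ : ℂ, (α ^ j).1 ≠ μ • 1)
    (hβ₃ : ∀ μ : ℂ, (β ^ 2).1 ≠ μ • 1) (hu : uα 1 = 0)
    (G : Subgroup (Matrix.unitaryGroup (Fin 2) ℂ)) (hαG : α ∈ G) (hβG : β ∈ G) :
    {x : ℝ | ∃ g ∈ G, Complex.normSq (g.1 0 0) = x}.Infinite := by
  intro hfin
  have hα10 : α.1 1 0 = 0 := by
    obtain ⟨μ, hμ⟩ := hfixα
    have e := congrFun hμ 1
    simp only [Matrix.mulVec, dotProduct, Fin.sum_univ_two, hu, Pi.smul_apply, smul_eq_mul,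
      mul_zero, add_zero] at e
    refine (mul_eq_zero.1 e).resolve_right fun h0 => huα (funext fun i => ?_)
    fin_cases i
    · exact h0
    · exact hu
  have ht : Complex.normSq (α.1 1 1) = 1 := by
    simpa [hα10] using unitary_row_normSq α 1
  obtain ⟨p, hp, hpow⟩ := hα₁
  have hpow' : α.1 0 0 ^ p = α.1 1 1 ^ p := by
    have h := coe_pow_eq_diagonal α hα10 p
    rw [hpow] at h
    have h0 := congrFun (congrFun h 0) 0
    have h1 := congrFun (congrFun h 1) 1
    simp at h0 h1
    rw [← h0, ← h1]
  obtain ⟨k, hk, hk'⟩ := exists_pow_re_ge_half _ _ ht p hp hpow' fun j h1 h5 he => by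
    refine hα₃ j h1 h5 (α.1 1 1 ^ j) ?_
    rw [coe_pow_eq_diagonal α hα10, he, diagonal_pair_eq_smul_one]
  have hd := coe_pow_eq_diagonal α hα10 k
  have hβ := subgroup_monomial_of_small_rotation G hfin (α ^ k) (G.pow_mem hαG k)
    (by simp [hd]) (by simpa [hd] using hk) (by simpa [hd] using hk') β hβG
  rcases hβ with h00 | hβ10
  · have h11 := unitary_antidiagonal_of_zero β h00
    refine hβ₃ (β.1 0 1 * β.1 1 0) ?_
    have h2 : (β ^ 2).1 = β.1 * β.1 := by rw [sq]; rfl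
    rw [h2]
    ext i j
    fin_cases i <;> fin_cases j <;> simp [Matrix.mul_apply, Fin.sum_univ_two, h00, h11, mul_comm]
  · have hβ01 := unitary_upper_zero_of_lower_zero β hβ10
    have ht' : Complex.normSq (β.1 1 1) = 1 := by
      simpa [hβ10] using unitary_row_normSq β 1
    have hγ10 : γ.1 1 0 = 0 := by
      obtain ⟨lam, hlam⟩ := hprod
      have h2 : (α * β * γ).1 = α.1 * β.1 * γ.1 := rfl
      have e := congrFun (congrFun (h2.symm.trans hlam) 1) 0
      simp only [Matrix.mul_apply, Fin.sum_univ_two, hα10, hβ10, hβ01, Matrix.smul_apply]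
        at e
      have hα0 : α.1 1 1 ≠ 0 := fun h => by simp [h] at ht
      have hβ0 : β.1 1 1 ≠ 0 := fun h => by simp [h] at ht'
      simpa [hα0, hβ0] using e
    have hb0 : uβ 0 = 0 := (eigenvector_coord_zero_of_diagonal β hβ10 hβ₂ uβ hfixβ).resolve_right
      fun h => hαβ (exists_smul_eq_of_coord_zero uα uβ huα 1 hu h)
    have hc0 : uγ 0 = 0 := (eigenvector_coord_zero_of_diagonal γ hγ10 hγ₂ uγ hfixγ).resolve_right
      fun h => hαγ (exists_smul_eq_of_coord_zero uα uγ huα 1 hu h)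
    exact hβγ (exists_smul_eq_of_coord_zero uβ uγ huβ 0 hb0 hc0)

theorem normSq_eq_one_of_smul_unitary (X A : Matrix.unitaryGroup (Fin 2) ℂ) (μ : ℂ)
    (h : X.1 = μ • A.1) : Complex.normSq μ = 1 := by
  have hX := unitary_col_normSq X
  have hA := unitary_col_normSq A
  rw [h] at hX
  simp only [Matrix.smul_apply, smul_eq_mul, map_mul] at hX
  rwa [← mul_add, hA, mul_one] at hX


/-- Infiniteness claim in the proof of Lemma 4.2: for `α, β, γ ∈ U(2)` as in the lemma, the
group they generate meets infinitely many scalar classes, i.e. its image in `PU(2)` is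
infinite. -/
theorem stmt_11 (α β γ : Matrix.unitaryGroup (Fin 2) ℂ)
    -- (i): finite order, not scalar
    (hα₁ : ∃ p : ℕ, 1 ≤ p ∧ α ^ p = 1)
    (hβ₁ : ∃ p : ℕ, 1 ≤ p ∧ β ^ p = 1)
    (hγ₁ : ∃ p : ℕ, 1 ≤ p ∧ γ ^ p = 1)
    (hα₂ : ∀ μ : ℂ, (↑α : Matrix (Fin 2) (Fin 2) ℂ) ≠ μ • 1)
    (hβ₂ : ∀ μ : ℂ, (↑β : Matrix (Fin 2) (Fin 2) ℂ) ≠ μ • 1)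
    (hγ₂ : ∀ μ : ℂ, (↑γ : Matrix (Fin 2) (Fin 2) ℂ) ≠ μ • 1)
    -- (ii): three distinct fixed lines
    (uα uβ uγ : Fin 2 → ℂ) (huα : uα ≠ 0) (huβ : uβ ≠ 0) (huγ : uγ ≠ 0)
    (hαβ : Submodule.span ℂ {uα} ≠ Submodule.span ℂ {uβ})
    (hβγ : Submodule.span ℂ {uβ} ≠ Submodule.span ℂ {uγ})
    (hαγ : Submodule.span ℂ {uα} ≠ Submodule.span ℂ {uγ})
    (hfixα : ∃ μ : ℂ, Matrix.mulVec (↑α : Matrix (Fin 2) (Fin 2) ℂ) uα = μ • uα)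
    (hfixβ : ∃ μ : ℂ, Matrix.mulVec (↑β : Matrix (Fin 2) (Fin 2) ℂ) uβ = μ • uβ)
    (hfixγ : ∃ μ : ℂ, Matrix.mulVec (↑γ : Matrix (Fin 2) (Fin 2) ℂ) uγ = μ • uγ)
    -- (iii): the product is scalar
    (hprod : ∃ lam : ℂ, (↑(α * β * γ) : Matrix (Fin 2) (Fin 2) ℂ) = lam • 1)
    -- (iv): the images of `α` and `β` in `PU(2)` have orders `> 5` and `> 2`
    (hα₃ : ∀ j : ℕ, 1 ≤ j → j ≤ 5 → ∀ μ : ℂ, (↑(α ^ j) : Matrix (Fin 2) (Fin 2) ℂ) ≠ μ • 1)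
    (hβ₃ : ∀ j : ℕ, 1 ≤ j → j ≤ 2 → ∀ μ : ℂ, (↑(β ^ j) : Matrix (Fin 2) (Fin 2) ℂ) ≠ μ • 1) :
    ¬ ∃ F : Finset (Matrix (Fin 2) (Fin 2) ℂ),
      (∀ A ∈ F, A ∈ Matrix.unitaryGroup (Fin 2) ℂ) ∧
      ∀ X ∈ Subgroup.closure ({α, β, γ} : Set (Matrix.unitaryGroup (Fin 2) ℂ)),
        ∃ A ∈ F, ∃ μ : ℂ, (↑X : Matrix (Fin 2) (Fin 2) ℂ) = μ • A := by
  rintro ⟨F, hF, hcover⟩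
  obtain ⟨P, c, hP⟩ := exists_unitary_smul_col uα huα
  have hPP : P.1 * (P⁻¹).1 = 1 := congrArg Subtype.val (mul_inv_cancel P)
  have hPP' : (P⁻¹).1 * P.1 = 1 := congrArg Subtype.val (inv_mul_cancel P)
  have hconj (X : Matrix.unitaryGroup (Fin 2) ℂ) :
      (MulAut.conj P⁻¹ X).1 = (P⁻¹).1 * X.1 * P.1 := by
    rw [MulAut.conj_apply, inv_inv]
    rfl
  have hscalar (X : Matrix.unitaryGroup (Fin 2) ℂ) (hX : ∀ μ : ℂ, X.1 ≠ μ • 1) (μ : ℂ) :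
      (MulAut.conj P⁻¹ X).1 ≠ μ • 1 := by
    intro h
    refine hX μ ?_
    calc X.1 = (P.1 * (P⁻¹).1) * X.1 * (P.1 * (P⁻¹).1) := by rw [hPP, one_mul, mul_one]
      _ = P.1 * (MulAut.conj P⁻¹ X).1 * (P⁻¹).1 := by rw [hconj]; simp only [mul_assoc]
      _ = μ • 1 := by rw [h, Matrix.mul_smul, mul_one, Matrix.smul_mul, hPP]
  have hback (v : Fin 2 → ℂ) : P.1.mulVec ((P⁻¹).1.mulVec v) = v := by
    rw [Matrix.mulVec_mulVec, hPP, Matrix.one_mulVec]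
  have hnz (v : Fin 2 → ℂ) (hv : v ≠ 0) : (P⁻¹).1.mulVec v ≠ 0 := by
    intro h
    rw [← hback v, h, Matrix.mulVec_zero] at hv
    exact hv rfl
  have hline (u v : Fin 2 → ℂ) (hv : v ≠ 0) (h : Submodule.span ℂ {u} ≠ Submodule.span ℂ {v}) :
      ¬ ∃ c : ℂ, (P⁻¹).1.mulVec v = c • (P⁻¹).1.mulVec u := by
    rintro ⟨d, hd⟩
    refine h (span_singleton_eq_of_exists_smul hv ⟨d, ?_⟩)
    rw [← hback v, hd, Matrix.mulVec_smul, hback]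
  have hfix (X : Matrix.unitaryGroup (Fin 2) ℂ) (v : Fin 2 → ℂ)
      (h : ∃ μ : ℂ, X.1.mulVec v = μ • v) :
      ∃ μ : ℂ, (MulAut.conj P⁻¹ X).1.mulVec ((P⁻¹).1.mulVec v) = μ • (P⁻¹).1.mulVec v := by
    obtain ⟨μ, hμ⟩ := h
    refine ⟨μ, ?_⟩
    rw [hconj, ← Matrix.mulVec_mulVec, hback, ← Matrix.mulVec_mulVec, hμ, Matrix.mulVec_smul]
  set G := Subgroup.closure ({α, β, γ} : Set (Matrix.unitaryGroup (Fin 2) ℂ))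
  refine infinite_of_fixed_coordinate_line (MulAut.conj P⁻¹ α) (MulAut.conj P⁻¹ β)
    (MulAut.conj P⁻¹ γ) ?_ (hscalar β hβ₂) (hscalar γ hγ₂)
    ((P⁻¹).1.mulVec uα) ((P⁻¹).1.mulVec uβ) ((P⁻¹).1.mulVec uγ) (hnz _ huα) (hnz _ huβ)
    (hline _ _ huβ hαβ) (hline _ _ huγ hβγ) (hline _ _ huγ hαγ)
    (hfix _ _ hfixα) (hfix _ _ hfixβ) (hfix _ _ hfixγ) ?_ ?_ ?_ ?_
    (G.map (MulAut.conj P⁻¹).toMonoidHom)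
    ⟨α, Subgroup.subset_closure (by simp), rfl⟩ ⟨β, Subgroup.subset_closure (by simp), rfl⟩ ?_
  · obtain ⟨p, hp, h⟩ := hα₁
    exact ⟨p, hp, by rw [← map_pow, h, map_one]⟩
  · obtain ⟨lam, h⟩ := hprod
    refine ⟨lam, ?_⟩
    rw [← map_mul, ← map_mul, hconj, h, Matrix.mul_smul, mul_one, Matrix.smul_mul, hPP']
  · intro j h1 h5
    rw [← map_pow]
    exact hscalar _ (hα₃ j h1 h5)
  · rw [← map_pow]
    exact hscalar _ (hβ₃ 2 (by norm_num) le_rfl)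
  · have hcol : uα = c • P.1.mulVec (Pi.single 0 1) := by
      ext i
      simp [hP i]
    rw [hcol, Matrix.mulVec_smul, Matrix.mulVec_mulVec, hPP', Matrix.one_mulVec]
    simp
  · refine (F.finite_toSet.image
      fun A => Complex.normSq (((P⁻¹).1 * A * P.1) 0 0)).subset ?_
    rintro _ ⟨_, ⟨g, hg, rfl⟩, rfl⟩
    obtain ⟨A, hA, μ, hμ⟩ := hcover g hg
    refine ⟨A, hA, ?_⟩
    have hμ1 := normSq_eq_one_of_smul_unitary g ⟨A, hF A hA⟩ μ hμ
    change _ = Complex.normSq ((MulAut.conj P⁻¹ g).1 0 0)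
    rw [hconj, hμ, Matrix.mul_smul, Matrix.smul_mul, Matrix.smul_apply, smul_eq_mul, map_mul, hμ1,
      one_mul]
end

section
/- Let U(2) = {A ∈ M₂(ℂ) : Aᴴ·A = I} and SU(2) = {A ∈ U(2) : det A = 1}. Let α, β, γ ∈ U(2) be such that: (i) each of α, β, γ has finite order and none is a complex scalar multiple of the identity matrix; (ii) there exist nonzero vectors u_α, u_β, u_γ ∈ ℂ² spanning three pairwise distinct complex lines, with α(u_α) ∈ ℂ·u_α, β(u_β) ∈ ℂ·u_β, γ(u_γ) ∈ ℂ·u_γ; (iii) α·β·γ = λ·I for some λ ∈ ℂ; (iv) α^j is not a scalar multiple of the identity for j = 1, …, 5, and β^j is not a scalar multiple of the identity for j = 1, 2. Then every subgroup H of SU(2) whose underlying set is closed and connected in M₂(ℂ) and which is normalized by each of α, β, γ satisfies H = {I} or H = SU(2). -/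
open Matrix

/-- The diagonal one-parameter subgroup `t ↦ diag(e^{it}, e^{-it})` of `U(2)`. -/
noncomputable def diagTorus : ℝ →+ Additive (unitaryGroup (Fin 2) ℂ) where
  toFun t := Additive.ofMul ⟨!![Complex.exp (t * Complex.I), 0; 0, Complex.exp (-(t * Complex.I))],
    mem_unitaryGroup_iff.2 <| by
      ext i j
      fin_cases i <;> fin_cases j <;>
        simp [Matrix.mul_apply, Matrix.star_apply, ← Complex.exp_conj, ← Complex.exp_add]⟩
  map_zero' := by
    rw [ofMul_eq_zero]
    ext i j
    fin_cases i <;> fin_cases j <;> simp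
  map_add' s t := by
    rw [← ofMul_mul]
    congr 1
    ext i j
    fin_cases i <;> fin_cases j <;>
      simp [← Complex.exp_add] <;> ring_nf

/-- The rotation one-parameter subgroup of `U(2)`. -/
noncomputable def rotTorus : ℝ →+ Additive (unitaryGroup (Fin 2) ℂ) where
  toFun t := Additive.ofMul ⟨!![(Real.cos t : ℂ), -(Real.sin t : ℂ); (Real.sin t : ℂ),
      (Real.cos t : ℂ)],
    mem_unitaryGroup_iff.2 <| by
      have h : (Real.cos t : ℂ) * Real.cos t + Real.sin t * Real.sin t = 1 := by
        rw [← sq, ← sq]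
        exact_mod_cast Real.cos_sq_add_sin_sq t
      ext i j
      fin_cases i <;> fin_cases j <;>
        simp only [Matrix.mul_apply, Matrix.star_apply, Fin.sum_univ_two] <;>
        simp [-Complex.ofReal_cos, -Complex.ofReal_sin] <;>
        first | ring1 | linear_combination h⟩
  map_zero' := by
    rw [ofMul_eq_zero]
    ext i j
    fin_cases i <;> fin_cases j <;> simp
  map_add' s t := by
    rw [← ofMul_mul]
    congr 1
    ext i j
    fin_cases i <;> fin_cases j <;>
      simp [Complex.cos_add, Complex.sin_add] <;> ring

lemma coe_diagTorus (t : ℝ) : ((diagTorus t).toMul : Matrix (Fin 2) (Fin 2) ℂ) =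
    !![Complex.exp (t * Complex.I), 0; 0, Complex.exp (-(t * Complex.I))] := rfl

lemma coe_rotTorus (t : ℝ) : ((rotTorus t).toMul : Matrix (Fin 2) (Fin 2) ℂ) =
    !![(Real.cos t : ℂ), -(Real.sin t : ℂ); (Real.sin t : ℂ), (Real.cos t : ℂ)] := rfl

lemma continuous_toMul_diagTorus : Continuous fun t => (diagTorus t).toMul := by
  refine Continuous.subtype_mk (continuous_matrix fun i j => ?_) _
  fin_cases i <;> fin_cases j <;> simp <;> fun_prop

lemma diagTorus_two_pi : diagTorus (2 * Real.pi) = 0 := by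
  rw [← toMul_eq_one]
  ext i j
  rw [coe_diagTorus]
  fin_cases i <;> fin_cases j <;> simp [Complex.exp_neg]

/-- A closed additive subgroup of `ℝ` with two incommensurable elements is everything. -/
lemma AddSubgroup.eq_top_of_isClosed_of_irrational_div {S : AddSubgroup ℝ}
    (hS : IsClosed (S : Set ℝ)) {a b : ℝ} (ha : a ∈ S) (hb : b ∈ S) (hab : Irrational (a / b)) :
    S = ⊤ := by
  have hd : Dense (S : Set ℝ) := (dense_addSubgroupClosure_pair_iff.2 hab).mono <| by
    rw [SetLike.coe_subset_coe, AddSubgroup.closure_le]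
    rintro x (rfl | rfl) <;> assumption
  rw [← AddSubgroup.coe_eq_univ, ← hS.closure_eq, hd.closure_eq]

/-- An additive subgroup of `ℝ` containing a nondegenerate interval `[0, ε]` is everything. -/
lemma AddSubgroup.eq_top_of_Icc_subset {S : AddSubgroup ℝ} {ε : ℝ} (hε : 0 < ε)
    (hS : Set.Icc 0 ε ⊆ S) : S = ⊤ := by
  have hpos : ∀ x, 0 ≤ x → x ∈ S := fun x hx => by
    obtain ⟨n, hn⟩ := exists_nat_gt (x / ε)
    have hn0 : (0 : ℝ) < n := (div_nonneg hx hε.le).trans_lt hn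
    have h1 : x / n ∈ S := hS ⟨by positivity, by
      rw [div_lt_iff₀ hε] at hn
      rw [div_le_iff₀ hn0]
      linarith⟩
    have h2 := S.nsmul_mem h1 n
    rwa [nsmul_eq_mul, mul_div_cancel₀ _ hn0.ne'] at h2
  refine (AddSubgroup.eq_top_iff' S).2 fun x => ?_
  rcases le_total 0 x with h | h
  · exact hpos x h
  · exact neg_mem_iff.1 (hpos (-x) (by linarith))

/-- For a matrix of determinant one in `U(2)` the inverse, i.e. the conjugate transpose, is
the adjugate. -/
lemma star_eq_adjugate_of_det_eq_one {A : unitaryGroup (Fin 2) ℂ}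
    (hA : (A : Matrix (Fin 2) (Fin 2) ℂ).det = 1) :
    star (A : Matrix (Fin 2) (Fin 2) ℂ) = adjugate (A : Matrix (Fin 2) (Fin 2) ℂ) := by
  have h1 := mul_adjugate (A : Matrix (Fin 2) (Fin 2) ℂ)
  rw [hA, one_smul] at h1
  calc star (A : Matrix (Fin 2) (Fin 2) ℂ)
      = star (A : Matrix (Fin 2) (Fin 2) ℂ) * (A * adjugate (A : Matrix (Fin 2) (Fin 2) ℂ)) := by
        rw [h1, mul_one]
    _ = _ := by rw [← mul_assoc, UnitaryGroup.star_mul_self, one_mul]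

/-- Euler angle decomposition of `SU(2)`. -/
lemma exists_eq_diagTorus_mul_rotTorus_mul_diagTorus {A : unitaryGroup (Fin 2) ℂ}
    (hA : (A : Matrix (Fin 2) (Fin 2) ℂ).det = 1) :
    ∃ s t : ℝ, A = (diagTorus s).toMul * (rotTorus (Real.arcsin ‖A 1 0‖)).toMul *
      (diagTorus t).toMul := by
  have h := star_eq_adjugate_of_det_eq_one hA
  have h11 : star (A 0 0) = A 1 1 := by
    simpa [adjugate_fin_two] using congrFun (congrFun h 0) 0
  have h01 : star (A 1 0) = - A 0 1 := by
    simpa [adjugate_fin_two] using congrFun (congrFun h 0) 1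
  have hnorm : ‖A 0 0‖ ^ 2 + ‖A 1 0‖ ^ 2 = 1 := by
    have h2 : A 0 0 * star (A 0 0) + A 1 0 * star (A 1 0) = 1 := by
      rw [h11, h01]
      rw [det_fin_two] at hA
      linear_combination hA
    simp only [Complex.star_def, Complex.mul_conj, Complex.normSq_eq_norm_sq] at h2
    exact_mod_cast h2
  have hsin : Real.sin (Real.arcsin ‖A 1 0‖) = ‖A 1 0‖ :=
    Real.sin_arcsin (by linarith [norm_nonneg (A 1 0)]) (by nlinarith [norm_nonneg (A 1 0)])
  have hcos : Real.cos (Real.arcsin ‖A 1 0‖) = ‖A 0 0‖ := by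
    rw [Real.cos_arcsin, ← hnorm, add_sub_cancel_right, Real.sqrt_sq (norm_nonneg _)]
  set x := (A 0 0).arg
  set y := (A 1 0).arg
  have hx : (‖A 0 0‖ : ℂ) * Complex.exp (x * Complex.I) = A 0 0 := Complex.norm_mul_exp_arg_mul_I _
  have hy : (‖A 1 0‖ : ℂ) * Complex.exp (y * Complex.I) = A 1 0 := Complex.norm_mul_exp_arg_mul_I _
  have hx' : (‖A 0 0‖ : ℂ) * Complex.exp (-(x * Complex.I)) = A 1 1 := by
    rw [← h11, ← hx]
    simp [← Complex.exp_conj]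
  have hy' : -(‖A 1 0‖ : ℂ) * Complex.exp (-(y * Complex.I)) = A 0 1 := by
    rw [← neg_eq_iff_eq_neg.2 h01, ← hy]
    simp [← Complex.exp_conj]
  refine ⟨(x - y) / 2, (x + y) / 2, ?_⟩
  ext i j
  simp only [UnitaryGroup.mul_val, coe_diagTorus, coe_rotTorus, hsin, hcos]
  have e (u v w : ℂ) (r : ℂ) (h : u + v = w) :
      Complex.exp u * r * Complex.exp v = r * Complex.exp w := by
    rw [← h, Complex.exp_add]
    ring
  fin_cases i <;> fin_cases j <;> simp [Matrix.mul_apply, Fin.sum_univ_two]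
  · linear_combination -hx - e ((x - y) / 2 * Complex.I) ((x + y) / 2 * Complex.I) _ ‖A 0 0‖
      (show _ = x * Complex.I by ring)
  · linear_combination -hy' + e ((x - y) / 2 * Complex.I) (-((x + y) / 2 * Complex.I)) _ ‖A 1 0‖
      (show _ = -(y * Complex.I) by ring)
  · linear_combination -hy - e (-((x - y) / 2 * Complex.I)) ((x + y) / 2 * Complex.I) _ ‖A 1 0‖
      (show _ = y * Complex.I by ring)
  · linear_combination -hx' - e (-((x - y) / 2 * Complex.I)) (-((x + y) / 2 * Complex.I)) _ ‖A 0 0‖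
      (show _ = -(x * Complex.I) by ring)

/-- Every element of `SU(2)` is conjugate to a diagonal one. -/
lemma exists_eq_conj_diagTorus {A : unitaryGroup (Fin 2) ℂ}
    (hA : (A : Matrix (Fin 2) (Fin 2) ℂ).det = 1) :
    ∃ (U : unitaryGroup (Fin 2) ℂ) (t : ℝ), A = U * (diagTorus t).toMul * U⁻¹ := by
  have hB : IsHermitian (Complex.I • ((A : Matrix (Fin 2) (Fin 2) ℂ) -
      star (A : Matrix (Fin 2) (Fin 2) ℂ))) := by
    simp only [IsHermitian, conjTranspose_smul, conjTranspose_sub, star_eq_conjTranspose,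
      conjTranspose_conjTranspose]
    simp [← smul_neg]
  have h0 : star (A : Matrix (Fin 2) (Fin 2) ℂ) =
      trace (A : Matrix (Fin 2) (Fin 2) ℂ) • 1 - ↑A := by
    rw [star_eq_adjugate_of_det_eq_one hA]
    ext i j
    fin_cases i <;> fin_cases j <;> simp [adjugate_fin_two, trace_fin_two]
  set U := hB.eigenvectorUnitary
  set D := U⁻¹ * A * U with hD
  have hsp := hB.conjStarAlgAut_star_eigenvectorUnitary
  have hDdiag : ∀ i j, i ≠ j → D i j = 0 := fun i j hij => by
    have h1 := congrFun (congrFun hsp i) j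
    have h2 : (star (U : Matrix (Fin 2) (Fin 2) ℂ)) * (Complex.I • ((A : Matrix (Fin 2) (Fin 2) ℂ) -
        star (A : Matrix (Fin 2) (Fin 2) ℂ))) * U =
          (2 * Complex.I) • (D : Matrix (Fin 2) (Fin 2) ℂ) -
          (Complex.I * trace (A : Matrix (Fin 2) (Fin 2) ℂ)) • 1 := by
      have h3 : (1 : Matrix (Fin 2) (Fin 2) ℂ) = star (U : Matrix (Fin 2) (Fin 2) ℂ) * U := by simp
      rw [h0]
      conv_rhs => rw [h3]
      simp only [hD, UnitaryGroup.mul_val, UnitaryGroup.inv_val, mul_sub, sub_mul, smul_sub,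
        mul_smul_comm, smul_mul_assoc, mul_one, smul_smul, mul_assoc]
      module
    rw [diagonal_apply_ne _ hij, Unitary.conjStarAlgAut_apply] at h1
    simp only [Unitary.coe_star, star_star] at h1
    rw [h2] at h1
    simpa [hij] using h1
  have hDdet : (D : Matrix (Fin 2) (Fin 2) ℂ).det = 1 := by
    have h3 : (star (U : Matrix (Fin 2) (Fin 2) ℂ) * U).det = 1 := by simp
    rw [det_mul] at h3
    simp only [hD, UnitaryGroup.mul_val, UnitaryGroup.inv_val, det_mul, hA, mul_one, h3]
  obtain ⟨s, t, hst⟩ := exists_eq_diagTorus_mul_rotTorus_mul_diagTorus hDdet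
  refine ⟨U, s + t, ?_⟩
  have h4 : D = (diagTorus (s + t)).toMul := by
    rw [hst, hDdiag 1 0 (by simp)]
    simp
  rw [← h4, hD]
  group

/-- A connected subgroup of `U(2)` containing the diagonal torus of `SU(2)` and a non-diagonal
matrix contains `SU(2)`. -/
lemma mem_of_diagTorus_mem_of_isPreconnected {H : Subgroup (unitaryGroup (Fin 2) ℂ)}
    (hdet : ∀ A ∈ H, (A : Matrix (Fin 2) (Fin 2) ℂ).det = 1)
    (hconn : IsPreconnected (H : Set (unitaryGroup (Fin 2) ℂ)))
    (hdiag : ∀ t, (diagTorus t).toMul ∈ H) {B : unitaryGroup (Fin 2) ℂ} (hB : B ∈ H)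
    (hB0 : B 1 0 ≠ 0) {A : unitaryGroup (Fin 2) ℂ}
    (hA : (A : Matrix (Fin 2) (Fin 2) ℂ).det = 1) : A ∈ H := by
  have hrot : ∀ C ∈ H, (rotTorus (Real.arcsin ‖C 1 0‖)).toMul ∈ H := fun C hC => by
    obtain ⟨s, t, h⟩ := exists_eq_diagTorus_mul_rotTorus_mul_diagTorus (hdet C hC)
    rw [h] at hC
    exact (H.mul_mem_cancel_left (hdiag s)).1 ((H.mul_mem_cancel_right (hdiag t)).1 hC)
  have hcont : Continuous fun C : unitaryGroup (Fin 2) ℂ => ‖C 1 0‖ :=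
    (continuous_subtype_val.matrix_elem 1 0).norm
  have hivt : Set.Icc 0 ‖B 1 0‖ ⊆ (fun C : unitaryGroup (Fin 2) ℂ => ‖C 1 0‖) '' H := by
    simpa using hconn.intermediate_value H.one_mem hB hcont.continuousOn
  have hBpos : 0 < ‖B 1 0‖ := norm_pos_iff.2 hB0
  have htop : (Subgroup.toAddSubgroup H).comap rotTorus = ⊤ :=
    AddSubgroup.eq_top_of_Icc_subset (Real.arcsin_pos.2 hBpos) fun x hx => by
      have hx1 : -(Real.pi / 2) ≤ x := by linarith [hx.1, Real.pi_pos]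
      have hx2 : x ≤ Real.pi / 2 := hx.2.trans (Real.arcsin_le_pi_div_two _)
      obtain ⟨C, hC, hCx⟩ := hivt ⟨Real.sin_nonneg_of_nonneg_of_le_pi hx.1
        (by linarith [Real.pi_pos]),
        (Real.le_arcsin_iff_sin_le' ⟨by linarith [hx.1, Real.pi_pos], hx2⟩).1 hx.2⟩
      have h := hrot C hC
      simp only at hCx
      rwa [hCx, Real.arcsin_sin hx1 hx2] at h
  obtain ⟨s, t, h⟩ := exists_eq_diagTorus_mul_rotTorus_mul_diagTorus hA
  rw [h]
  refine H.mul_mem (H.mul_mem (hdiag s) ?_) (hdiag t)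
  exact (AddSubgroup.eq_top_iff' _).1 htop _

lemma re_trace_conj_diagTorus (U : unitaryGroup (Fin 2) ℂ) (t : ℝ) :
    (trace ((U * (diagTorus t).toMul * U⁻¹ : unitaryGroup (Fin 2) ℂ) :
      Matrix (Fin 2) (Fin 2) ℂ)).re = 2 * Real.cos t := by
  simp only [UnitaryGroup.mul_val, UnitaryGroup.inv_val]
  rw [trace_mul_comm, ← mul_assoc, UnitaryGroup.star_mul_self, one_mul, coe_diagTorus,
    trace_fin_two]
  simp [Complex.exp_re]
  ring

/-- A nontrivial closed connected subgroup of `SU(2)` contains a maximal torus. -/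
lemma exists_conj_diagTorus_mem {H : Subgroup (unitaryGroup (Fin 2) ℂ)}
    (hdet : ∀ A ∈ H, (A : Matrix (Fin 2) (Fin 2) ℂ).det = 1)
    (hclosed : IsClosed (H : Set (unitaryGroup (Fin 2) ℂ)))
    (hconn : IsPreconnected (H : Set (unitaryGroup (Fin 2) ℂ)))
    {A : unitaryGroup (Fin 2) ℂ} (hA : A ∈ H) (hA1 : A ≠ 1) :
    ∃ U : unitaryGroup (Fin 2) ℂ, ∀ t, U * (diagTorus t).toMul * U⁻¹ ∈ H := by
  let f : unitaryGroup (Fin 2) ℂ → ℝ := fun C => (trace (C : Matrix (Fin 2) (Fin 2) ℂ)).re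
  have hcont : Continuous f := Complex.continuous_re.comp continuous_subtype_val.matrix_trace
  obtain ⟨V, s, hV⟩ := exists_eq_conj_diagTorus (hdet A hA)
  have hfA : f A = 2 * Real.cos s := by rw [hV]; exact re_trace_conj_diagTorus V s
  have hf1 : f 1 = 2 := by simp [f]
  have hs : Real.cos s < 1 := by
    refine (Real.cos_le_one s).lt_of_ne fun h => hA1 ?_
    obtain ⟨n, hn⟩ := (Real.cos_eq_one_iff s).1 h
    rw [hV, ← hn, ← zsmul_eq_mul, map_zsmul, diagTorus_two_pi]
    simp
  obtain ⟨r, hr, hr0, hrs⟩ : ∃ r, Irrational r ∧ 0 < r ∧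
      r < Real.arccos (Real.cos s) / (2 * Real.pi) :=
    exists_irrational_btwn (div_pos (Real.arccos_pos.2 hs) (by positivity))
  set θ := r * (2 * Real.pi) with hθ
  have hθ0 : 0 < θ := by positivity
  have hθs : θ < Real.arccos (Real.cos s) := (lt_div_iff₀ (by positivity)).1 hrs
  have hcosθ : Real.cos s ≤ Real.cos θ := by
    rw [← Real.cos_arccos (Real.neg_one_le_cos s) (Real.cos_le_one s)]
    exact Real.cos_le_cos_of_nonneg_of_le_pi hθ0.le (Real.arccos_le_pi _) hθs.le
  obtain ⟨B, hB, hBθ⟩ := hconn.intermediate_value hA H.one_mem hcont.continuousOn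
    (show 2 * Real.cos θ ∈ Set.Icc (f A) (f 1) by
      rw [hfA, hf1]
      exact ⟨by linarith, by linarith [Real.cos_le_one θ]⟩)
  obtain ⟨U, t, hU⟩ := exists_eq_conj_diagTorus (hdet B hB)
  refine ⟨U, ?_⟩
  have htθ : Real.cos t = Real.cos θ := by
    have h : f B = 2 * Real.cos t := by rw [hU]; exact re_trace_conj_diagTorus U t
    linarith
  let S : AddSubgroup ℝ :=
    (Subgroup.toAddSubgroup (H.comap (MulAut.conj U).toMonoidHom)).comap diagTorus
  have hmem : ∀ x, x ∈ S ↔ U * (diagTorus x).toMul * U⁻¹ ∈ H := fun x => Iff.rfl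
  have hS : IsClosed (S : Set ℝ) := hclosed.preimage
    (f := fun x => U * (diagTorus x).toMul * U⁻¹)
    ((continuous_const.mul continuous_toMul_diagTorus).mul continuous_const)
  have hpi : 2 * Real.pi ∈ S := by
    rw [hmem, diagTorus_two_pi]
    simp
  have ht : t ∈ S := by rwa [hmem, ← hU]
  have hθS : θ ∈ S := by
    obtain ⟨k, hk⟩ := Real.cos_eq_cos_iff.1 htθ
    have hkS : 2 * (k : ℝ) * Real.pi ∈ S := by
      have := S.zsmul_mem hpi k
      rw [zsmul_eq_mul] at this
      convert this using 1
      ring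
    rcases hk with hk | hk
    · rw [hk]
      exact S.add_mem hkS ht
    · rw [hk]
      exact S.sub_mem hkS ht
  have hirr : Irrational (θ / (2 * Real.pi)) := by
    rwa [hθ, mul_div_cancel_right₀ _ (by positivity)]
  have htop := AddSubgroup.eq_top_of_isClosed_of_irrational_div hS hθS hpi hirr
  exact fun x => (hmem x).1 (htop ▸ AddSubgroup.mem_top x)

/-- A unitary matrix conjugating `diag(i, -i)` to an upper triangular matrix is diagonal, unless
its square is scalar. -/
lemma diagonal_of_conj_diagTorus {A : unitaryGroup (Fin 2) ℂ}
    (hA : (A * (diagTorus (Real.pi / 2)).toMul * A⁻¹) 1 0 = 0)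
    (hA2 : ∀ μ : ℂ, ((A ^ 2 : unitaryGroup (Fin 2) ℂ) : Matrix (Fin 2) (Fin 2) ℂ) ≠ μ • 1) :
    A 0 1 = 0 ∧ A 1 0 = 0 := by
  have hexp : Complex.exp (((Real.pi / 2 : ℝ) : ℂ) * Complex.I) = Complex.I := by
    rw [Complex.ofReal_div, Complex.ofReal_ofNat, Complex.exp_pi_div_two_mul_I]
  have h1 : A 1 0 * Complex.I * star (A 0 0) - A 1 1 * Complex.I * star (A 0 1) = 0 := by
    simp only [UnitaryGroup.mul_val, UnitaryGroup.inv_val, coe_diagTorus, Complex.exp_neg, hexp,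
      Matrix.mul_apply, Matrix.star_apply, Fin.sum_univ_two] at hA
    simpa [← sub_eq_add_neg] using hA
  have hu := mem_unitaryGroup_iff.1 A.2
  have h2 : A 1 0 * star (A 0 0) + A 1 1 * star (A 0 1) = 0 := by
    simpa [Matrix.mul_apply, Matrix.star_apply] using congrFun (congrFun hu 1) 0
  have h00 : A 0 0 * star (A 0 0) + A 0 1 * star (A 0 1) = 1 := by
    simpa [Matrix.mul_apply, Matrix.star_apply] using congrFun (congrFun hu 0) 0
  have h11 : A 1 0 * star (A 1 0) + A 1 1 * star (A 1 1) = 1 := by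
    simpa [Matrix.mul_apply, Matrix.star_apply] using congrFun (congrFun hu 1) 1
  have h3 : A 1 0 * star (A 0 0) = 0 := by
    linear_combination (1 / 2) * h2 - (Complex.I / 2) * h1 +
      (1 / 2) * (A 1 0 * star (A 0 0) - A 1 1 * star (A 0 1)) * Complex.I_sq
  have h4 : A 1 1 * star (A 0 1) = 0 := by linear_combination h2 - h3
  rcases mul_eq_zero.1 h3 with h | h
  · refine ⟨?_, h⟩
    rcases mul_eq_zero.1 h4 with h' | h'
    · simp [h, h'] at h11
    · exact star_eq_zero.1 h'
  · have h5 : A 0 0 = 0 := star_eq_zero.1 h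
    rcases mul_eq_zero.1 h4 with h' | h'
    · refine absurd ?_ (hA2 (A 0 1 * A 1 0))
      ext i j
      rw [sq]
      fin_cases i <;> fin_cases j <;> simp [Matrix.mul_apply, h5, h', mul_comm]
    · simp [h5, star_eq_zero.1 h'] at h00

/-- If conjugation by `U` makes the non-scalar matrix `A` diagonal, then the eigenlines of `A` are
spanned by the columns of `U`. -/
lemma exists_span_eq_span_col {A U : unitaryGroup (Fin 2) ℂ}
    (h01 : (U⁻¹ * A * U) 0 1 = 0) (h10 : (U⁻¹ * A * U) 1 0 = 0)
    (hA : ∀ μ : ℂ, (A : Matrix (Fin 2) (Fin 2) ℂ) ≠ μ • 1) {u : Fin 2 → ℂ} (hu : u ≠ 0)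
    (hfix : ∃ μ : ℂ, (A : Matrix (Fin 2) (Fin 2) ℂ) *ᵥ u = μ • u) :
    ∃ i, Submodule.span ℂ {u} = Submodule.span ℂ {(U : Matrix (Fin 2) (Fin 2) ℂ).col i} := by
  obtain ⟨μ, hμ⟩ := hfix
  set D := U⁻¹ * A * U with hD
  set v := (U⁻¹ : unitaryGroup (Fin 2) ℂ).1 *ᵥ u with hv
  have hUv : u = U.1 *ᵥ v := by
    rw [hv, mulVec_mulVec, ← UnitaryGroup.mul_val, mul_inv_cancel, UnitaryGroup.one_val, one_mulVec]
  have hDv : D.1 *ᵥ v = μ • v := by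
    rw [hv, mulVec_mulVec, ← UnitaryGroup.mul_val, hD, mul_inv_cancel_right, UnitaryGroup.mul_val,
      ← mulVec_mulVec, hμ, mulVec_smul]
  have hne : D 0 0 ≠ D 1 1 := fun h => hA (D 0 0) <| by
    have hDs : (D : Matrix (Fin 2) (Fin 2) ℂ) = D 0 0 • 1 := by
      ext i j
      fin_cases i <;> fin_cases j <;> simp [h01, h10, h]
    have hAD : A = U * D * U⁻¹ := by
      rw [hD]
      group
    conv_lhs => rw [hAD, UnitaryGroup.mul_val, UnitaryGroup.mul_val, hDs]
    rw [mul_smul_comm, smul_mul_assoc, mul_one, ← UnitaryGroup.mul_val, mul_inv_cancel,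
      UnitaryGroup.one_val]
  have e0 : D 0 0 * v 0 = μ * v 0 := by
    simpa [mulVec, dotProduct, h01] using congrFun hDv 0
  have e1 : D 1 1 * v 1 = μ * v 1 := by
    simpa [mulVec, dotProduct, h10] using congrFun hDv 1
  have key : ∀ i j, i ≠ j → v i = 0 →
      Submodule.span ℂ {u} = Submodule.span ℂ {(U : Matrix (Fin 2) (Fin 2) ℂ).col j} :=
    fun i j hij hi => by
      have hu' : u = v j • (U : Matrix (Fin 2) (Fin 2) ℂ).col j := by
        rw [hUv]
        ext k
        fin_cases i <;> fin_cases j <;>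
          simp_all [-hUv, mulVec, dotProduct, Matrix.col, mul_comm]
      have hj : v j ≠ 0 := fun h => hu (by rw [hu', h, zero_smul])
      rw [hu', Submodule.span_singleton_smul_eq (IsUnit.mk0 _ hj)]
  by_cases h0 : v 0 = 0
  · exact ⟨1, key 0 1 (by simp) h0⟩
  · refine ⟨0, key 1 0 (by simp) ?_⟩
    by_contra h1
    exact hne ((mul_right_cancel₀ h0 e0).trans (mul_right_cancel₀ h1 e1).symm)

/-- If `A` and `B` are diagonal and `A * B * C` is scalar, then `C` is diagonal. -/
lemma diagonal_of_mul_mul_eq_smul_one {A B C : unitaryGroup (Fin 2) ℂ}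
    (hA01 : A 0 1 = 0) (hA10 : A 1 0 = 0) (hB01 : B 0 1 = 0) (hB10 : B 1 0 = 0) {c : ℂ}
    (h : ((A * B * C : unitaryGroup (Fin 2) ℂ) : Matrix (Fin 2) (Fin 2) ℂ) = c • 1) :
    C 0 1 = 0 ∧ C 1 0 = 0 := by
  have hdetA := (UnitaryGroup.det_isUnit A).ne_zero
  have hdetB := (UnitaryGroup.det_isUnit B).ne_zero
  simp only [det_fin_two, hA01, hB01, zero_mul, sub_zero, mul_ne_zero_iff] at hdetA hdetB
  have h01 := congrFun (congrFun h 0) 1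
  have h10 := congrFun (congrFun h 1) 0
  simp only [UnitaryGroup.mul_val, Matrix.mul_apply, Fin.sum_univ_two] at h01 h10
  simp [hA01, hA10, hB01, hB10, hdetA, hdetB] at h01 h10
  exact ⟨h01, h10⟩


/-- Lemma 4.2: with `α, β, γ ∈ U(2)` as in the lemma, every closed connected subgroup of
`SU(2)` normalized by `α`, `β` and `γ` is trivial or all of `SU(2)`. -/
theorem stmt_12 (α β γ : Matrix.unitaryGroup (Fin 2) ℂ)
    -- (i): finite order, not scalar
    (hα₁ : ∃ p : ℕ, 1 ≤ p ∧ α ^ p = 1)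
    (hβ₁ : ∃ p : ℕ, 1 ≤ p ∧ β ^ p = 1)
    (hγ₁ : ∃ p : ℕ, 1 ≤ p ∧ γ ^ p = 1)
    (hα₂ : ∀ μ : ℂ, (↑α : Matrix (Fin 2) (Fin 2) ℂ) ≠ μ • 1)
    (hβ₂ : ∀ μ : ℂ, (↑β : Matrix (Fin 2) (Fin 2) ℂ) ≠ μ • 1)
    (hγ₂ : ∀ μ : ℂ, (↑γ : Matrix (Fin 2) (Fin 2) ℂ) ≠ μ • 1)
    -- (ii): three distinct fixed lines
    (uα uβ uγ : Fin 2 → ℂ) (huα : uα ≠ 0) (huβ : uβ ≠ 0) (huγ : uγ ≠ 0)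
    (hαβ : Submodule.span ℂ {uα} ≠ Submodule.span ℂ {uβ})
    (hβγ : Submodule.span ℂ {uβ} ≠ Submodule.span ℂ {uγ})
    (hαγ : Submodule.span ℂ {uα} ≠ Submodule.span ℂ {uγ})
    (hfixα : ∃ μ : ℂ, Matrix.mulVec (↑α : Matrix (Fin 2) (Fin 2) ℂ) uα = μ • uα)
    (hfixβ : ∃ μ : ℂ, Matrix.mulVec (↑β : Matrix (Fin 2) (Fin 2) ℂ) uβ = μ • uβ)
    (hfixγ : ∃ μ : ℂ, Matrix.mulVec (↑γ : Matrix (Fin 2) (Fin 2) ℂ) uγ = μ • uγ)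
    -- (iii): the product is scalar
    (hprod : ∃ lam : ℂ, (↑(α * β * γ) : Matrix (Fin 2) (Fin 2) ℂ) = lam • 1)
    -- (iv): the images of `α` and `β` in `PU(2)` have orders `> 5` and `> 2`
    (hα₃ : ∀ j : ℕ, 1 ≤ j → j ≤ 5 → ∀ μ : ℂ, (↑(α ^ j) : Matrix (Fin 2) (Fin 2) ℂ) ≠ μ • 1)
    (hβ₃ : ∀ j : ℕ, 1 ≤ j → j ≤ 2 → ∀ μ : ℂ, (↑(β ^ j) : Matrix (Fin 2) (Fin 2) ℂ) ≠ μ • 1)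
    -- `H` a subgroup of `SU(2)` …
    (H : Subgroup (Matrix.unitaryGroup (Fin 2) ℂ))
    (hHdet : ∀ A ∈ H, (↑A : Matrix (Fin 2) (Fin 2) ℂ).det = 1)
    -- … whose underlying set is closed and connected in `M₂(ℂ)` …
    (hclosed : IsClosed ((fun A : Matrix.unitaryGroup (Fin 2) ℂ =>
      (↑A : Matrix (Fin 2) (Fin 2) ℂ)) '' (H : Set (Matrix.unitaryGroup (Fin 2) ℂ))))
    (hconn : IsConnected ((fun A : Matrix.unitaryGroup (Fin 2) ℂ =>
      (↑A : Matrix (Fin 2) (Fin 2) ℂ)) '' (H : Set (Matrix.unitaryGroup (Fin 2) ℂ))))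
    -- … and normalized by `α`, `β` and `γ`
    (hnormα : ∀ X : Matrix.unitaryGroup (Fin 2) ℂ, X ∈ H ↔ α * X * α⁻¹ ∈ H)
    (hnormβ : ∀ X : Matrix.unitaryGroup (Fin 2) ℂ, X ∈ H ↔ β * X * β⁻¹ ∈ H)
    (hnormγ : ∀ X : Matrix.unitaryGroup (Fin 2) ℂ, X ∈ H ↔ γ * X * γ⁻¹ ∈ H) :
    (∀ A : Matrix.unitaryGroup (Fin 2) ℂ, A ∈ H ↔ A = 1) ∨
    (∀ A : Matrix.unitaryGroup (Fin 2) ℂ, A ∈ H ↔ (↑A : Matrix (Fin 2) (Fin 2) ℂ).det = 1) := by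
  rcases H.bot_or_exists_ne_one with hbot | ⟨A, hA, hA1⟩
  · exact .inl fun A => by rw [hbot, Subgroup.mem_bot]
  refine .inr fun B => ⟨hHdet B, fun hB => ?_⟩
  have hHclosed : IsClosed (H : Set (unitaryGroup (Fin 2) ℂ)) := by
    rw [← Set.preimage_image_eq (H : Set (unitaryGroup (Fin 2) ℂ)) Subtype.val_injective]
    exact hclosed.preimage continuous_subtype_val
  have hHconn : IsPreconnected (H : Set (unitaryGroup (Fin 2) ℂ)) :=
    Topology.IsInducing.subtypeVal.isPreconnected_image.1 hconn.isPreconnected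
  obtain ⟨U, hU⟩ := exists_conj_diagTorus_mem hHdet hHclosed hHconn hA hA1
  let K : Subgroup (unitaryGroup (Fin 2) ℂ) := H.comap (MulAut.conj U).toMonoidHom
  have hK : ∀ X, X ∈ K ↔ U * X * U⁻¹ ∈ H := fun X => Iff.rfl
  have hdetconj : ∀ X : unitaryGroup (Fin 2) ℂ, ((U * X * U⁻¹ : unitaryGroup (Fin 2) ℂ) :
      Matrix (Fin 2) (Fin 2) ℂ).det = (X : Matrix (Fin 2) (Fin 2) ℂ).det := fun X => by
    have h : ((U * U⁻¹ : unitaryGroup (Fin 2) ℂ) : Matrix (Fin 2) (Fin 2) ℂ).det = 1 := by simp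
    rw [UnitaryGroup.mul_val, det_mul] at h
    rw [UnitaryGroup.mul_val, UnitaryGroup.mul_val, det_mul, det_mul]
    linear_combination (X : Matrix (Fin 2) (Fin 2) ℂ).det * h
  have hKdet : ∀ X ∈ K, (X : Matrix (Fin 2) (Fin 2) ℂ).det = 1 := fun X hX => by
    rw [← hdetconj]
    exact hHdet _ hX
  have hKconn : IsPreconnected (K : Set (unitaryGroup (Fin 2) ℂ)) := by
    have hKH : (K : Set (unitaryGroup (Fin 2) ℂ)) = (fun X => U⁻¹ * X * U) '' H := by
      ext X
      refine ⟨fun hX => ⟨_, hX, by simp [mul_assoc]⟩, ?_⟩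
      rintro ⟨Y, hY, rfl⟩
      rw [SetLike.mem_coe, hK]
      simpa [mul_assoc] using hY
    rw [hKH]
    exact hHconn.image _
      ((continuous_const.mul continuous_id).mul continuous_const).continuousOn
  by_cases hdiag : ∀ C ∈ K, C 1 0 = 0
  · exfalso
    have hconj : ∀ δ : unitaryGroup (Fin 2) ℂ, (∀ X, X ∈ H ↔ δ * X * δ⁻¹ ∈ H) →
        (∀ μ : ℂ, ((δ ^ 2 : unitaryGroup (Fin 2) ℂ) : Matrix (Fin 2) (Fin 2) ℂ) ≠ μ • 1) →
        (U⁻¹ * δ * U) 0 1 = 0 ∧ (U⁻¹ * δ * U) 1 0 = 0 := fun δ hδ hδ2 => by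
      refine diagonal_of_conj_diagTorus (hdiag _ ?_) fun μ h => hδ2 μ ?_
      · rw [hK]
        convert (hδ _).1 (hU (Real.pi / 2)) using 1
        group
      · have h' : δ ^ 2 = U * (U⁻¹ * δ * U) ^ 2 * U⁻¹ := by
          rw [sq, sq]
          group
        rw [h', UnitaryGroup.mul_val, UnitaryGroup.mul_val, h, mul_smul_comm, smul_mul_assoc,
          mul_one, ← UnitaryGroup.mul_val, mul_inv_cancel, UnitaryGroup.one_val]
    obtain ⟨hα01, hα10⟩ := hconj α hnormα (hα₃ 2 (by norm_num) (by norm_num))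
    obtain ⟨hβ01, hβ10⟩ := hconj β hnormβ (hβ₃ 2 (by norm_num) (by norm_num))
    obtain ⟨lam, hlam⟩ := hprod
    obtain ⟨hγ01, hγ10⟩ := diagonal_of_mul_mul_eq_smul_one hα01 hα10 hβ01 hβ10
      (C := U⁻¹ * γ * U) (c := lam) <| by
        have h' : U⁻¹ * α * U * (U⁻¹ * β * U) * (U⁻¹ * γ * U) = U⁻¹ * (α * β * γ) * U := by group
        rw [h', UnitaryGroup.mul_val, UnitaryGroup.mul_val, hlam, mul_smul_comm, smul_mul_assoc,
          mul_one, ← UnitaryGroup.mul_val, inv_mul_cancel, UnitaryGroup.one_val]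
    obtain ⟨i, hi⟩ := exists_span_eq_span_col hα01 hα10 hα₂ huα hfixα
    obtain ⟨j, hj⟩ := exists_span_eq_span_col hβ01 hβ10 hβ₂ huβ hfixβ
    obtain ⟨k, hk⟩ := exists_span_eq_span_col hγ01 hγ10 hγ₂ huγ hfixγ
    have hij : i ≠ j := fun h => hαβ (by rw [hi, hj, h])
    have hjk : j ≠ k := fun h => hβγ (by rw [hj, hk, h])
    have hik : i ≠ k := fun h => hαγ (by rw [hi, hk, h])
    omega
  · push Not at hdiag
    obtain ⟨C, hC, hC0⟩ := hdiag
    have hmem := mem_of_diagTorus_mem_of_isPreconnected hKdet hKconn hU hC hC0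
      (A := U⁻¹ * B * U) (by rw [← hdetconj, ← hB]; simp [mul_assoc])
    rw [hK] at hmem
    simpa [mul_assoc] using hmem
end

section
/- Let A ∈ M₂(ℂ) with Aᴴ·A = I (A unitary). Suppose there are two distinct complex lines ℓ, ℓ' ⊆ ℂ² such that A maps ℓ onto ℓ' and ℓ' onto ℓ. Then A² is a complex scalar multiple of the identity matrix. -/
open Matrix

/-- The Cayley–Hamilton identity for `2×2` matrices. -/
theorem Matrix.mul_self_eq_trace_smul_sub_det_smul {R : Type*} [CommRing R]
    (A : Matrix (Fin 2) (Fin 2) R) : A * A = A.trace • A - A.det • 1 := by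
  ext i j
  fin_cases i <;> fin_cases j <;>
    simp [Matrix.mul_apply, Fin.sum_univ_two, Matrix.trace_fin_two, Matrix.det_fin_two] <;> ring

/-- If the trace of a `2×2` matrix `A` is nonzero, every subspace stable under `A * A` is
stable under `A`. -/
theorem Matrix.map_mulVecLin_le_of_trace_ne_zero {K : Type*} [Field K]
    {A : Matrix (Fin 2) (Fin 2) K} (hA : A.trace ≠ 0) {p : Submodule K (Fin 2 → K)}
    (hp : ∀ x ∈ p, A *ᵥ (A *ᵥ x) ∈ p) : p.map A.mulVecLin ≤ p := by
  rintro _ ⟨x, hx, rfl⟩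
  have h : A.trace • (A *ᵥ x) = A *ᵥ (A *ᵥ x) + A.det • x := by
    rw [mulVec_mulVec, mul_self_eq_trace_smul_sub_det_smul, sub_mulVec, smul_mulVec,
      smul_mulVec, one_mulVec, sub_add_cancel]
  rw [mulVecLin_apply, ← p.smul_mem_iff hA, h]
  exact p.add_mem (hp x hx) (p.smul_mem _ hx)

/-- Step in the proof of Lemma 4.2: a unitary `2×2` matrix exchanging two distinct complex
lines of `ℂ²` has scalar square. -/
theorem stmt_13 (A : Matrix (Fin 2) (Fin 2) ℂ) (hA : Aᴴ * A = 1)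
    (ℓ ℓ' : Submodule ℂ (Fin 2 → ℂ))
    (hl : Module.finrank ℂ ℓ = 1) (hl' : Module.finrank ℂ ℓ' = 1)
    (hne : ℓ ≠ ℓ')
    (h₁ : Submodule.map (Matrix.mulVecLin A) ℓ = ℓ')
    (h₂ : Submodule.map (Matrix.mulVecLin A) ℓ' = ℓ) :
    ∃ μ : ℂ, A * A = μ • 1 := by
  have htr : A.trace = 0 := by
    by_contra htr
    have hle : ℓ' ≤ ℓ := h₁ ▸ map_mulVecLin_le_of_trace_ne_zero htr fun x hx =>
      h₂ ▸ Submodule.mem_map_of_mem (h₁ ▸ Submodule.mem_map_of_mem hx)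
    exact hne (Submodule.eq_of_le_of_finrank_eq hle (hl'.trans hl.symm)).symm
  exact ⟨-A.det, by rw [mul_self_eq_trace_smul_sub_det_smul, htr, zero_smul, zero_sub, neg_smul]⟩
end
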